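/- arXiv:1404.3805 — 5 statements merged into one kernel-verified Lean document; each statement's English description precedes it below -/
import Mathlib

section
/- Let S_1 ⊆ S_2 ⊆ … ⊆ S_n be a chain of nonempty proper subsets of [n+1], and let λ be the Young diagram defined by λ_i = |S_{n+1−i}| for i = 1,…,n (so λ_1 ≥ … ≥ λ_n ≥ 1 and λ_1 ≤ n). Then in R_n one has τ_{S_1}·τ_{S_2}⋯τ_{S_n} = I(λ) · τ_{{1}}·τ_{{1,2}}⋯τ_{{1,…,n}}. (This is the algebraic form of the type A_n intersection-number formula: the product τ_{{1}}⋯τ_{{1,…,n}} is the class of a point, so the intersection number ⟨τ_{S_1}⋯τ_{S_n}, μ_X⟩ equals I(λ).) -/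
open MvPolynomial

/-- Index type: nonempty proper subsets of `[n+1]` (realized as `Fin (n+1)`). -/
abbrev IdxA (n : ℕ) := {S : Finset (Fin (n + 1)) // S.Nonempty ∧ S ≠ Finset.univ}

/-- Generators of the defining ideal of `R_n`: (i) products `τ_S τ_T` for incomparable `S, T`;
(ii) the linear relations `Σ_{k∈S, l∉S} τ_S − Σ_{k∉S, l∈S} τ_S` for `k, l ∈ [n+1]`. -/
def relA (n : ℕ) : Set (MvPolynomial (IdxA n) ℤ) :=
  {p | ∃ S T : IdxA n, ¬ S.1 ⊆ T.1 ∧ ¬ T.1 ⊆ S.1 ∧ p = X S * X T} ∪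
  {p | ∃ k l : Fin (n + 1), p =
      (∑ S : IdxA n, if k ∈ S.1 ∧ l ∉ S.1 then X S else 0) -
      (∑ S : IdxA n, if k ∉ S.1 ∧ l ∈ S.1 then X S else 0)}

/-- The ring `R_n`. -/
abbrev RA (n : ℕ) := MvPolynomial (IdxA n) ℤ ⧸ Ideal.span (relA n)

/-- The class `τ_S ∈ R_n`, with the convention `τ_∅ = τ_{[n+1]} = 1`. -/
noncomputable def tauA (n : ℕ) (S : Finset (Fin (n + 1))) : RA n :=
  if h : S.Nonempty ∧ S ≠ Finset.univ then Ideal.Quotient.mk _ (X (⟨S, h⟩ : IdxA n)) else 1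

/-- The subset `{1, …, i}` of `[n+1]`, as a subset of `Fin (n+1)`. -/
def initSeg (n i : ℕ) : Finset (Fin (n + 1)) :=
  Finset.univ.filter (fun x : Fin (n + 1) => (x : ℕ) < i)

/-- The class of a point: `τ_{{1}} ⋯ τ_{{1,…,n}}`. -/
noncomputable def ptA (n : ℕ) : RA n := ∏ i ∈ Finset.Icc 1 n, tauA n (initSeg n i)

/-- `λ_i` extended by `0` for `i > n`. -/
def lamE (n : ℕ) (lam : ℕ → ℕ) (i : ℕ) : ℕ := if i ≤ n then lam i else 0

/-- The sorted list `i_1 < … < i_s` of lower-right corners of `λ`. -/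
def cornerL (n : ℕ) (lam : ℕ → ℕ) : List ℕ :=
  ((Finset.Icc 1 n).filter (fun i => lamE n lam (i + 1) < lamE n lam i)).sort (· ≤ ·)

/-- The number `s` of lower-right corners of `λ`. -/
def sC (n : ℕ) (lam : ℕ → ℕ) : ℕ := (cornerL n lam).length

/-- `i_r` (with `i_0 = 0`; out-of-range indices default to `n+1`, where `λ` vanishes). -/
def iC (n : ℕ) (lam : ℕ → ℕ) (r : ℕ) : ℕ :=
  if r = 0 then 0 else (cornerL n lam).getD (r - 1) (n + 1)

/-- `a_r = i_r − i_{r−1} − 1`. -/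
def aC (n : ℕ) (lam : ℕ → ℕ) (r : ℕ) : ℤ := (iC n lam r : ℤ) - iC n lam (r - 1) - 1

/-- `b_r = λ_{i_r} − λ_{i_{r+1}} − 1` (with `λ_{i_{s+1}} = 0`). -/
def bC (n : ℕ) (lam : ℕ → ℕ) (r : ℕ) : ℤ :=
  (lamE n lam (iC n lam r) : ℤ) - lamE n lam (iC n lam (r + 1)) - 1

/-- `c_r = λ_{i_r} + i_r − n − 1`. -/
def cC (n : ℕ) (lam : ℕ → ℕ) (r : ℕ) : ℤ :=
  (lamE n lam (iC n lam r) : ℤ) + iC n lam r - n - 1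

/-- Binomial coefficient `C(x,y)` with `C(x,y) = 0` unless `0 ≤ y ≤ x`. -/
def Cb (x y : ℤ) : ℤ := if 0 ≤ y ∧ y ≤ x then (x.toNat.choose y.toNat : ℤ) else 0

/-- `y_r = C(a_r, c_r) · C(b_r, c_r)`. -/
def yC (n : ℕ) (lam : ℕ → ℕ) (r : ℕ) : ℤ :=
  Cb (aC n lam r) (cC n lam r) * Cb (bC n lam r) (cC n lam r)

/-- `I(λ) = (−1)^{n+s} y_1 ⋯ y_s`. -/
def IY (n : ℕ) (lam : ℕ → ℕ) : ℤ :=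
  (-1) ^ (n + sC n lam) * ∏ r ∈ Finset.Icc 1 (sC n lam), yC n lam r

namespace WeylChamber

open Finset

variable {α R : Type*} [CommRing R]

/-- A family `τ` satisfying the defining relations of the toric ring of the Weyl chambers of type
`A`, with the convention that `τ ∅ = τ univ = 1`. -/
structure IsDivisorSystem [Fintype α] [DecidableEq α] (τ : Finset α → R) : Prop where
  empty : τ ∅ = 1
  univ : τ univ = 1
  mul_eq_zero : ∀ S T, ¬ S ⊆ T → ¬ T ⊆ S → τ S * τ T = 0
  linear : ∀ k l, ∑ S with k ∈ S ∧ l ∉ S, τ S = ∑ S with k ∉ S ∧ l ∈ S, τ S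

namespace IsDivisorSystem

variable [Fintype α] [DecidableEq α] {τ : Finset α → R}

lemma mul_eq_zero_of_dvd (hτ : IsDivisorSystem τ) {x : R} {F S : Finset α} (hx : τ F ∣ x)
    (h₁ : ¬ F ⊆ S) (h₂ : ¬ S ⊆ F) : x * τ S = 0 := by
  obtain ⟨y, rfl⟩ := hx
  rw [mul_right_comm, hτ.mul_eq_zero F S h₁ h₂, zero_mul]

lemma mul_erase_eq_single (hτ : IsDivisorSystem τ) {x : R} {U : Finset α} {a b : α}
    (ha : a ∈ U) (hab : a ≠ b) (hU : τ U ∣ x) (hG : τ ((U.erase a).erase b) ∣ x)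
    (hb : b ∈ U) :
    ∑ S with a ∈ S ∧ b ∉ S, x * τ S = x * τ (U.erase b) := by
  refine sum_eq_single _ (fun S hS hne => ?_) (fun h => ?_)
  · simp only [mem_filter, mem_univ, true_and] at hS
    by_cases hSU : S ⊆ U
    · by_cases hGS : (U.erase a).erase b ⊆ S
      · refine absurd (Subset.antisymm ?_ ?_) hne
        · intro y hy
          exact mem_erase.2 ⟨fun h => hS.2 (h ▸ hy), hSU hy⟩
        · intro y hy
          by_cases hya : y = a
          · exact hya ▸ hS.1
          · exact hGS (by simp_all)
      · refine hτ.mul_eq_zero_of_dvd hG hGS fun h => ?_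
        simpa using h hS.1
    · exact hτ.mul_eq_zero_of_dvd hU (fun h => hS.2 (h hb)) hSU
  · simp_all

lemma mul_erase_comm (hτ : IsDivisorSystem τ) {x : R} {U : Finset α} {a b : α}
    (ha : a ∈ U) (hb : b ∈ U) (hU : τ U ∣ x) (hG : τ ((U.erase a).erase b) ∣ x) :
    x * τ (U.erase a) = x * τ (U.erase b) := by
  rcases eq_or_ne a b with rfl | hab
  · rfl
  have h := congrArg (x * ·) (hτ.linear a b)
  simp only [mul_sum] at h
  rw [hτ.mul_erase_eq_single ha hab hU hG hb] at h
  simp only [and_comm (a := a ∉ _)] at h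
  rw [hτ.mul_erase_eq_single hb hab.symm hU (by rwa [erase_right_comm]) ha] at h
  exact h.symm

/-- The excess intersection relation: a factor `τ F` that occurs at least twice in a monomial is
traded for the sets that refine the chain just above or just below `F`. -/
lemma mul_self_eq (hτ : IsDivisorSystem τ) {x : R} {G F U : Finset α} {k l : α}
    (hGF : G ⊆ F) (hFU : F ⊆ U) (hkF : k ∈ F) (hkG : k ∉ G) (hlU : l ∈ U) (hlF : l ∉ F)
    (hG : τ G ∣ x) (hF : τ F ∣ x) (hU : τ U ∣ x) :
    x * τ F = -∑ T ∈ (Icc F (U.erase l)).erase F, x * τ T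
      - ∑ T ∈ (Icc (insert k G) F).erase F, x * τ T := by
  have h := congrArg (x * ·) (hτ.linear k l)
  simp only [mul_sum] at h
  have h₀ : ∑ S with k ∉ S ∧ l ∈ S, x * τ S = 0 := by
    refine sum_eq_zero fun S hS => ?_
    simp only [mem_filter, mem_univ, true_and] at hS
    exact hτ.mul_eq_zero_of_dvd hF (fun h => hS.1 (h hkF)) (fun h => hlF (h hS.2))
  have hdisj : Disjoint ((Icc F (U.erase l)).erase F) ((Icc (insert k G) F).erase F) := by
    refine disjoint_left.2 fun T h₁ h₂ => ?_
    simp only [mem_erase, mem_Icc] at h₁ h₂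
    exact h₁.1 (h₂.2.2.antisymm h₁.2.1)
  have hnot : F ∉ ((Icc F (U.erase l)).erase F) ∪ ((Icc (insert k G) F).erase F) := by simp
  have h₁ : ∑ S with k ∈ S ∧ l ∉ S, x * τ S =
      ∑ T ∈ insert F (((Icc F (U.erase l)).erase F) ∪ ((Icc (insert k G) F).erase F)),
        x * τ T := by
    symm
    refine sum_subset (fun T hT => ?_) (fun T hT hT' => ?_)
    · simp only [mem_insert, mem_union, mem_erase, mem_Icc] at hT
      simp only [mem_filter, mem_univ, true_and]
      rcases hT with rfl | ⟨-, h₁, h₂⟩ | ⟨-, h₁, h₂⟩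
      · exact ⟨hkF, hlF⟩
      · exact ⟨h₁ hkF, fun h => by simpa using h₂ h⟩
      · exact ⟨h₁ (mem_insert_self _ _), fun h => hlF (h₂ h)⟩
    · simp only [mem_filter, mem_univ, true_and] at hT
      simp only [mem_insert, mem_union, mem_erase, mem_Icc, not_or] at hT'
      obtain ⟨hne, hup, hdown⟩ := hT'
      by_cases hFT : F ⊆ T
      · refine hτ.mul_eq_zero_of_dvd hU (fun h => hT.2 (h hlU)) fun h => hup ⟨hne, hFT, ?_⟩
        exact fun y hy => mem_erase.2 ⟨fun e => hT.2 (e ▸ hy), h hy⟩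
      by_cases hTF : T ⊆ F
      · refine hτ.mul_eq_zero_of_dvd hG (fun h => hdown ⟨hne, ?_, hTF⟩) fun h => hkG (h hT.1)
        exact insert_subset hT.1 h
      · exact hτ.mul_eq_zero_of_dvd hF hFT hTF
  rw [h₀, h₁, sum_insert hnot, sum_union hdisj] at h
  linear_combination h

end IsDivisorSystem

/-- `IsFlagProd τ U y` says that `y` is the product of `τ` over the proper members of a complete
flag of subsets of `U`. -/
inductive IsFlagProd [DecidableEq α] (τ : Finset α → R) : Finset α → R → Prop
  | empty : IsFlagProd τ ∅ 1
  | step {U : Finset α} {a : α} {y : R} (ha : a ∈ U) (hy : IsFlagProd τ (U.erase a) y) :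
      IsFlagProd τ U (τ (U.erase a) * y)

lemma IsFlagProd.exists [DecidableEq α] (τ : Finset α → R) (U : Finset α) :
    ∃ y, IsFlagProd τ U y := by
  induction U using Finset.induction with
  | empty => exact ⟨1, .empty⟩
  | insert a s ha ih =>
    obtain ⟨y, hy⟩ := ih
    exact ⟨_, .step (mem_insert_self a s) (by rwa [erase_insert ha])⟩

lemma IsFlagProd.unique [Fintype α] [DecidableEq α] {τ : Finset α → R}
    (hτ : IsDivisorSystem τ) {U : Finset α} {y z : R}
    (hy : IsFlagProd τ U y) (hz : IsFlagProd τ U z) : τ U * y = τ U * z := by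
  induction U using Finset.strongInduction generalizing y z with
  | H U ih =>
    cases hy with
    | empty => cases hz with
      | empty => rfl
      | step ha _ => simp at ha
    | @step _ a y ha hy => cases hz with
      | empty => simp at ha
      | @step _ b z hb hz =>
        rcases eq_or_ne a b with rfl | hab
        · rw [ih _ (erase_ssubset ha) hy hz]
        obtain ⟨w, hw⟩ := IsFlagProd.exists τ ((U.erase a).erase b)
        have h₁ := ih _ (erase_ssubset ha) hy (.step (mem_erase.2 ⟨hab.symm, hb⟩) hw)
        have h₂ := ih _ (erase_ssubset hb) hz (.step (U := U.erase b) (a := a) (y := w)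
          (mem_erase.2 ⟨hab, ha⟩) (by rwa [erase_right_comm]))
        rw [erase_right_comm] at h₂
        have h₃ := hτ.mul_erase_comm (x := τ U * τ ((U.erase a).erase b)) ha hb
          (Dvd.intro _ rfl) (Dvd.intro_left _ rfl)
        linear_combination τ U * h₁ - τ U * h₂ + w * h₃

/-- A monomial in the `τ F` is encoded by a list of pairs `(i, F)`: the sets `F` are strictly
decreasing and `i` is the number of factors indexed by supersets of `F`. -/
def monomial (τ : Finset α → R) : ℕ → List (ℕ × Finset α) → R
  | _, [] => 1
  | p, (i, F) :: L => τ F ^ (i - p) * monomial τ i L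

/-- `L` continues a chain of total degree `n` whose smallest set so far is `U`, reached after `p`
factors. -/
def IsChainFrom (n : ℕ) : ℕ → Finset α → List (ℕ × Finset α) → Prop
  | p, _, [] => p = n
  | p, U, (i, F) :: L => p < i ∧ F.Nonempty ∧ F ⊂ U ∧ IsChainFrom n i F L

/-- The signed product of binomial coefficients attached to a chain which continues a set of size
`u` reached after `p` factors. -/
def weight (n : ℕ) : ℕ → ℕ → List (ℕ × Finset α) → ℤ
  | p, u, [] => Cb (u - 1) (u + p - n - 1)
  | p, u, (i, F) :: L => (-1) ^ (i + p + 1) * Cb (u - F.card - 1) (u + p - n - 1) *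
      Cb (i - p - 1) (F.card + i - n - 1) * weight n i F.card L

lemma IsChainFrom.length_le {n p : ℕ} {U : Finset α} {L : List (ℕ × Finset α)}
    (h : IsChainFrom n p U L) : L.length + p ≤ n := by
  induction L generalizing p U with
  | nil => simp [IsChainFrom] at h; simp [h]
  | cons a L ih =>
    obtain ⟨i, F⟩ := a
    have := ih h.2.2.2
    have := h.1
    simp only [List.length_cons]
    omega

lemma Cb_of_neg {x y : ℤ} (h : x < 0) : Cb x y = 0 := if_neg (by omega)

lemma Cb_zero_left (y : ℤ) : Cb 0 y = if y = 0 then 1 else 0 := by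
  unfold Cb
  by_cases h : y = 0
  · simp [h]
  · rw [if_neg (by omega), if_neg h]

lemma Cb_zero_right {x : ℤ} (h : 0 ≤ x) : Cb x 0 = 1 := by simp [Cb, h]

lemma Cb_self {x : ℤ} (h : 0 ≤ x) : Cb x x = 1 := by simp [Cb, h]

lemma Cb_natCast (x y : ℕ) : Cb x y = x.choose y := by
  unfold Cb
  by_cases h : y ≤ x
  · simp [h]
  · rw [if_neg (by omega), Nat.choose_eq_zero_of_lt (by omega)]; rfl

lemma Cb_symm {x y : ℤ} : Cb x (x - y) = Cb x y := by
  unfold Cb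
  by_cases h : 0 ≤ y ∧ y ≤ x
  · rw [if_pos h, if_pos (by omega)]
    rw [show (x - y).toNat = x.toNat - y.toNat by omega, Nat.choose_symm (by omega)]
  · rw [if_neg h, if_neg (by omega)]

lemma Cb_pascal {x y : ℤ} (h : 0 < x) : Cb x y = Cb (x - 1) y + Cb (x - 1) (y - 1) := by
  obtain ⟨m, rfl⟩ : ∃ m : ℕ, x = m + 1 := ⟨(x - 1).toNat, by omega⟩
  rcases lt_trichotomy y 0 with hy | rfl | hy
  · simp [Cb, hy.not_ge, (show ¬ 1 ≤ y by omega)]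
  · rw [Cb_zero_right (by omega), Cb_zero_right (by omega)]; simp [Cb]
  · obtain ⟨k, rfl⟩ : ∃ k : ℕ, y = k + 1 := ⟨(y - 1).toNat, by omega⟩
    rw [add_sub_cancel_right, add_sub_cancel_right]
    have h₁ := Cb_natCast (m + 1) (k + 1)
    have h₂ := Cb_natCast m (k + 1)
    push_cast at h₁ h₂
    rw [h₁, h₂, Cb_natCast, Nat.choose_succ_succ]
    push_cast
    ring

/-- A sum over an interval of finsets of a function concentrated in cardinality `t`. -/
lemma sum_Icc_card [DecidableEq α] {A B : Finset α} (hAB : A ⊆ B) (t : ℤ) (c : ℤ) :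
    ∑ T ∈ Icc A B, (if (T.card : ℤ) = t then c else 0) =
      Cb (B.card - A.card) (t - A.card) * c := by
  have hinj : Set.InjOn (A ∪ ·) ((B \ A).powerset : Set (Finset α)) := by
    intro S hS T hT h
    simp only [coe_powerset, Set.mem_preimage, Set.mem_powerset_iff, coe_subset] at hS hT
    have hd : ∀ V ⊆ B \ A, (A ∪ V) \ A = V := fun V hV =>
      union_sdiff_cancel_left (disjoint_sdiff.mono_right hV)
    rw [← hd S hS, ← hd T hT]
    exact congrArg (· \ A) h
  rw [Icc_eq_image_powerset hAB, sum_image hinj]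
  have hcard : ∀ T ∈ (B \ A).powerset, (if ((A ∪ T).card : ℤ) = t then c else 0) =
      (fun m : ℕ => if ((A.card + m : ℕ) : ℤ) = t then c else 0) T.card := fun T hT => by
    rw [card_union_of_disjoint (disjoint_sdiff.mono_right (mem_powerset.1 hT))]
  rw [sum_congr rfl hcard, sum_powerset_apply_card
    (fun m : ℕ => if ((A.card + m : ℕ) : ℤ) = t then c else 0), card_sdiff_of_subset hAB]
  have hle := card_le_card hAB
  by_cases ht : (A.card : ℤ) ≤ t
  · obtain ⟨m, rfl⟩ : ∃ m : ℕ, t = A.card + m := ⟨(t - A.card).toNat, by omega⟩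
    rw [add_sub_cancel_left, ← Nat.cast_sub hle, Cb_natCast]
    simp only [Nat.cast_add, add_right_inj, Nat.cast_inj, smul_ite, smul_zero]
    rw [sum_ite_eq' (range (B.card - A.card + 1)) m]
    split_ifs with h
    · simp
    · rw [Nat.choose_eq_zero_of_lt (by simp at h; omega)]; simp
  · rw [sum_eq_zero (fun m _ => by rw [if_neg (by omega), smul_zero])]
    rw [Cb, if_neg (by omega), zero_mul]

/-- The part of the weight of a chain that does not depend on the size of the preceding set. -/
def weightTail (n : ℕ) (i : ℕ) : List (ℕ × Finset α) → ℤ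
  | [] => 1
  | (j, F) :: L => (-1) ^ (j + i + 1) * Cb (j - i - 1) (F.card + j - n - 1) * weight n j F.card L

/-- The largest set of a chain, or the empty set. -/
def top : List (ℕ × Finset α) → Finset α
  | [] => ∅
  | (_, F) :: _ => F

lemma weight_eq (n i u : ℕ) (L : List (ℕ × Finset α)) :
    weight n i u L = Cb (u - (top L).card - 1) (u + i - n - 1) * weightTail n i L := by
  cases L with
  | nil => simp [weight, weightTail, top]
  | cons a L => simp only [weight, weightTail, top]; ring

lemma sum_weight_above [DecidableEq α] {n p i : ℕ} {F U : Finset α} {l : α}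
    (L : List (ℕ × Finset α))
    (hFU : F ⊆ U) (hl : l ∈ U) (hlF : l ∉ F) :
    ∑ T ∈ Icc F (U.erase l), weight n p U.card ((p + 1, T) :: (i, F) :: L) =
      (-1) ^ (i + p) * Cb (U.card - F.card - 1) (U.card + p - n - 1) *
        Cb (i - p - 2) (F.card + i - n - 1) * weight n i F.card L := by
  have hsub : F ⊆ U.erase l := subset_erase.2 ⟨hFU, hlF⟩
  have hle := card_le_card hsub
  have hcU : (U.erase l).card + 1 = U.card := card_erase_add_one hl
  set c := (-1) ^ (i + p) * Cb (i - p - 2) (F.card + i - n - 1) * weight n i F.card L with hc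
  have key : ∀ T ∈ Icc F (U.erase l), weight n p U.card ((p + 1, T) :: (i, F) :: L) =
      if (T.card : ℤ) = n - p then (if (n - p : ℤ) < U.card then c else 0) else 0 := by
    intro T hT
    have hT' := mem_Icc.1 hT
    have h₁ := card_le_card hT'.1
    have h₂ := card_le_card hT'.2
    simp only [weight]
    push_cast
    rw [show (p + 1 - p - 1 : ℤ) = 0 by ring, Cb_zero_left]
    by_cases h : (T.card : ℤ) = n - p
    · rw [if_pos (by omega), if_pos h, if_pos (by omega), h,
        show (U.card - (n - p) - 1 : ℤ) = U.card + p - n - 1 by ring, Cb_self (by omega)]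
      rw [show (n - p + (p + 1) - n - 1 : ℤ) = 0 by ring]
      rw [show (i - (p + 1) - 1 : ℤ) = i - p - 2 by ring]
      have hs : (-1 : ℤ) ^ (p + 1 + p + 1) * (-1) ^ (i + (p + 1) + 1) = (-1) ^ (i + p) := by
        rw [← pow_add, show p + 1 + p + 1 + (i + (p + 1) + 1) = i + p + 2 * (p + 2) by ring,
          pow_add, pow_mul]
        simp
      by_cases hlt : F.card < T.card
      · rw [Cb_zero_right (by omega), hc]
        linear_combination Cb (i - p - 2) (F.card + i - n - 1) * weight n i F.card L * hs
      · have hz : Cb (i - p - 2) (F.card + i - n - 1) = 0 := if_neg (by omega)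
        rw [hc, hz]
        ring
    · rw [if_neg (by omega), if_neg h]
      ring
  rw [sum_congr rfl key, sum_Icc_card hsub]
  rw [show (((U.erase l).card : ℤ) - F.card) = U.card - F.card - 1 by omega]
  rw [← Cb_symm, show (U.card - F.card - 1 - (n - p - F.card) : ℤ) = U.card + p - n - 1 by ring]
  split_ifs with h
  · rw [hc]; ring
  · rw [show Cb (U.card - F.card - 1) (U.card + p - n - 1) = 0 from if_neg (by omega)]; ring

lemma sum_weight_below [DecidableEq α] {n p i u : ℕ} {F : Finset α} {k : α}
    (L : List (ℕ × Finset α))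
    (hGF : top L ⊆ F) (hk : k ∈ F) (hkG : k ∉ top L) (hi : p + 2 ≤ i) :
    ∑ T ∈ Icc (insert k (top L)) F, weight n p u ((i - 1, F) :: (i, T) :: L) =
      (-1) ^ (i + p) * Cb (u - F.card - 1) (u + p - n - 1) *
        Cb (i - p - 2) (F.card + i - n - 1 - 1) * weight n i F.card L := by
  have hsub : insert k (top L) ⊆ F := insert_subset hk hGF
  have hle := card_le_card hsub
  have hcG : (insert k (top L)).card = (top L).card + 1 := card_insert_of_notMem hkG
  set c := (-1) ^ (i + p) * Cb (u - F.card - 1) (u + p - n - 1) *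
    Cb (i - p - 2) (F.card + i - n - 1 - 1) * weightTail n i L with hc
  have key : ∀ T ∈ Icc (insert k (top L)) F, weight n p u ((i - 1, F) :: (i, T) :: L) =
      if (T.card : ℤ) = n + 1 - i then c else 0 := by
    intro T hT
    have hT' := mem_Icc.1 hT
    have h₁ := card_le_card hT'.1
    have h₂ := card_le_card hT'.2
    rw [weight, weight, weight_eq]
    obtain ⟨i, rfl⟩ : ∃ j, i = j + 1 := ⟨i - 1, by omega⟩
    push_cast
    rw [show (i + 1 - i - 1 : ℤ) = 0 by ring, Cb_zero_left]
    by_cases h : (T.card : ℤ) = n + 1 - (i + 1)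
    · rw [if_pos (by omega), if_pos h, h,
        show (n + 1 - (i + 1) + (i + 1) - n - 1 : ℤ) = 0 by ring, Cb_zero_right (by omega), hc,
        show (F.card - (n + 1 - (i + 1)) - 1 : ℤ) = F.card + i - n - 1 by ring,
        show (((i + 1 : ℕ) : ℤ) - p - 2) = i - p - 1 by push_cast; ring,
        show ((F.card : ℤ) + (i + 1 : ℕ) - n - 1 - 1) = F.card + i - n - 1 by push_cast; ring]
      have hs : (-1 : ℤ) ^ (i + p + 1) * (-1) ^ (i + 1 + i + 1) = (-1) ^ (i + 1 + p) := by
        rw [← pow_add, show i + p + 1 + (i + 1 + i + 1) = i + 1 + p + 2 * (i + 1) by ring,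
          pow_add, pow_mul]
        simp
      by_cases hlt : T.card < F.card
      · rw [Cb_self (by omega)]
        linear_combination Cb (u - F.card - 1) (u + p - n - 1) *
          Cb (i - p - 1) (F.card + i - n - 1) * weightTail n (i + 1) L * hs
      · have hz : Cb (i - p - 1) (F.card + i - n - 1) = 0 := if_neg (by omega)
        rw [hz]
        ring
    · rw [if_neg (by omega), if_neg h]
      ring
  rw [sum_congr rfl key, sum_Icc_card hsub, hcG, weight_eq, ← Cb_symm]
  rw [show ((F.card : ℤ) - ((top L).card + 1 : ℕ) - (n + 1 - i - ((top L).card + 1 : ℕ))) =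
    F.card + i - n - 1 by ring,
    show ((F.card : ℤ) - ((top L).card + 1 : ℕ)) = F.card - (top L).card - 1 by push_cast; ring, hc]
  ring

/-- The numerical counterpart of `IsDivisorSystem.mul_self_eq`. -/
lemma weight_recursion [DecidableEq α] {n p i : ℕ} {F U : Finset α} {k l : α}
    (L : List (ℕ × Finset α))
    (hGF : top L ⊆ F) (hFU : F ⊆ U) (hk : k ∈ F) (hkG : k ∉ top L) (hl : l ∈ U) (hlF : l ∉ F)
    (hi : p + 2 ≤ i) :
    weight n p U.card ((i, F) :: L) =
      -∑ T ∈ (Icc F (U.erase l)).erase F, weight n p U.card ((p + 1, T) :: (i, F) :: L)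
      - ∑ T ∈ (Icc (insert k (top L)) F).erase F,
        weight n p U.card ((i - 1, F) :: (i, T) :: L) := by
  rw [sum_erase, sum_erase, sum_weight_above L hFU hl hlF, sum_weight_below L hGF hk hkG hi,
    weight, Cb_pascal (x := i - p - 1) (by omega), show (i - p - 1 - 1 : ℤ) = i - p - 2 by ring]
  · ring
  · simp [weight, Cb_of_neg]
  · simp [weight, Cb_of_neg]

/-- Either a chain is a complete flag, or it has a first set of multiplicity at least two. -/
lemma IsChainFrom.flag_or_split [Fintype α] [DecidableEq α] {τ : Finset α → R}
    (hτ : IsDivisorSystem τ) {n p : ℕ} {U : Finset α} {L : List (ℕ × Finset α)}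
    (h : IsChainFrom n p U L) (hne : U.Nonempty) (hU : U.card + p ≤ n + 1) :
    (U.card + p = n + 1 ∧ IsFlagProd τ U (monomial τ p L) ∧ weight n p U.card L = 1) ∨
    ∃ (A : List (ℕ × Finset α)) (q : ℕ) (V : Finset α) (i : ℕ) (F : Finset α)
      (B : List (ℕ × Finset α)) (K : ℤ) (x : R),
      L = A ++ (i, F) :: B ∧ q + 2 ≤ i ∧ τ V ∣ τ U * x ∧ IsChainFrom n q V ((i, F) :: B) ∧
      ∀ L', (IsChainFrom n q V L' → IsChainFrom n p U (A ++ L')) ∧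
        weight n p U.card (A ++ L') = K * weight n q V.card L' ∧
        monomial τ p (A ++ L') = x * monomial τ q L' := by
  induction L generalizing p U with
  | nil =>
    obtain rfl : p = n := h
    have hc : U.card = 1 := by have := hne.card_pos; omega
    obtain ⟨a, rfl⟩ := card_eq_one.1 hc
    refine .inl ⟨by simp [add_comm], ?_, ?_⟩
    · have := IsFlagProd.step (τ := τ) (mem_singleton_self a)
        (by rw [erase_singleton]; exact .empty)
      simpa [monomial, hτ.empty] using this
    · simp [weight, Cb]
  | cons e L ih =>
    obtain ⟨i, F⟩ := e
    have h' := h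
    obtain ⟨hpi, hF, hFU, hL⟩ := h
    by_cases hi : p + 2 ≤ i
    · exact .inr ⟨[], p, U, i, F, L, 1, 1, rfl, hi, by simp, h', by simp⟩
    obtain rfl : i = p + 1 := by omega
    have hlt := card_lt_card hFU
    rcases ih hL hF (by omega) with
      ⟨hc, hfl, hw⟩ | ⟨A, q, V, i, F', B, K, x, rfl, hqi, hV, hB, hA⟩
    · left
      have hcU : U.card = F.card + 1 := by omega
      refine ⟨by omega, ?_, ?_⟩
      · obtain ⟨a, ha, haF⟩ := exists_of_ssubset hFU
        obtain rfl : F = U.erase a := eq_of_subset_of_card_le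
          (subset_erase.2 ⟨hFU.1, haF⟩) (by rw [card_erase_of_mem ha]; omega)
        simpa [monomial] using IsFlagProd.step ha hfl
      · rw [weight, hw, hcU]
        push_cast
        rw [show (F.card + 1 - F.card - 1 : ℤ) = 0 by ring,
          show (p + 1 - p - 1 : ℤ) = 0 by ring, Cb_zero_left, Cb_zero_left, if_pos (by omega),
          if_pos (by omega), show p + 1 + p + 1 = 2 * (p + 1) by ring, pow_mul]
        simp
    · right
      refine ⟨(p + 1, F) :: A, q, V, i, F', B, (-1) ^ (p + 1 + p + 1) *
        Cb (U.card - F.card - 1) (U.card + p - n - 1) *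
        Cb ((p + 1 : ℕ) - p - 1) (F.card + (p + 1 : ℕ) - n - 1) * K, τ F * x, rfl, hqi,
        hV.mul_left _, hB, fun L' => ⟨fun hL' => ?_, ?_, ?_⟩⟩
      · exact ⟨hpi, hF, hFU, (hA L').1 hL'⟩
      · rw [List.cons_append, weight, (hA L').2.1]
        ring
      · rw [List.cons_append, monomial, (hA L').2.2]
        simp [mul_assoc]

/-- Every monomial of top degree is its weight times the monomial of any complete flag. -/
theorem monomial_eq_weight_mul [Fintype α] [DecidableEq α] {τ : Finset α → R}
    (hτ : IsDivisorSystem τ) {n : ℕ} (hα : Fintype.card α = n + 1) {y : R}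
    (hy : IsFlagProd τ univ y) {L : List (ℕ × Finset α)} (hL : IsChainFrom n 0 univ L) :
    monomial τ 0 L = (weight n 0 (n + 1) L : R) * y := by
  have hcard : (univ : Finset α).card = n + 1 := by rw [card_univ, hα]
  have hne : (univ : Finset α).Nonempty := card_pos.1 (by omega)
  induction hm : n - L.length using Nat.strong_induction_on generalizing L with
  | _ m ih =>
  have step : ∀ L' : List (ℕ × Finset α), L'.length = L.length + 1 → IsChainFrom n 0 univ L' →
      monomial τ 0 L' = (weight n 0 (n + 1) L' : R) * y := fun L' hlen hL' =>
    ih _ (by have := hL'.length_le; omega) hL' rfl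
  rcases hL.flag_or_split hτ hne (by omega) with
    ⟨-, hfl, hw⟩ | ⟨A, q, V, i, F, B, K, x, rfl, hqi, hV, ⟨-, hF, hFV, hB⟩, hA⟩
  · rw [hcard] at hw
    simpa [hw, hτ.univ] using hfl.unique hτ hy
  rw [hcard] at hA
  rw [hτ.univ, one_mul] at hV
  have hGF : top B ⊂ F := by
    cases B with
    | nil => exact empty_ssubset.2 hF
    | cons b B => exact hB.2.2.1
  obtain ⟨k, hk, hkG⟩ := exists_of_ssubset hGF
  obtain ⟨l, hl, hlF⟩ := exists_of_ssubset hFV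
  set z := x * τ F ^ (i - (q + 1)) * monomial τ i B with hz
  have hzF : τ F ∣ z := Dvd.dvd.mul_right (Dvd.dvd.mul_left (dvd_pow_self _ (by omega)) _) _
  have hzV : τ V ∣ z := (hV.mul_right _).mul_right _
  have hzG : τ (top B) ∣ z := by
    refine Dvd.dvd.mul_left ?_ _
    cases B with
    | nil => simp [top, hτ.empty]
    | cons b B => exact (dvd_pow_self _ (by have := hB.1; omega)).mul_right _
  have hmon : monomial τ 0 (A ++ (i, F) :: B) = z * τ F := by
    rw [(hA _).2.2, monomial, show i - q = i - (q + 1) + 1 by omega, pow_succ]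
    ring
  have above : ∀ T ∈ (Icc F (V.erase l)).erase F, z * τ T =
      (K * weight n q V.card ((q + 1, T) :: (i, F) :: B) : ℤ) * y := by
    intro T hT
    simp only [mem_erase, mem_Icc] at hT
    obtain ⟨hTF, hFT, hTV⟩ := hT
    have hc : IsChainFrom n q V ((q + 1, T) :: (i, F) :: B) :=
      ⟨by omega, hF.mono hFT, hTV.trans_ssubset (erase_ssubset hl), by omega, hF,
        hFT.ssubset_of_ne hTF.symm, hB⟩
    have := step _ (by simp only [List.length_append, List.length_cons]; omega) ((hA _).1 hc)
    rw [(hA _).2.1, (hA _).2.2] at this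
    rw [← this, monomial, monomial, hz]
    simp only [add_tsub_cancel_left, pow_one]
    ring
  have below : ∀ T ∈ (Icc (insert k (top B)) F).erase F, z * τ T =
      (K * weight n q V.card ((i - 1, F) :: (i, T) :: B) : ℤ) * y := by
    intro T hT
    simp only [mem_erase, mem_Icc] at hT
    obtain ⟨hTF, hGT, hTF'⟩ := hT
    have hBT : IsChainFrom n i T B := by
      cases B with
      | nil => exact hB
      | cons b B =>
        exact ⟨hB.1, hB.2.1, (ssubset_insert hkG).trans_subset hGT, hB.2.2.2⟩
    have hc : IsChainFrom n q V ((i - 1, F) :: (i, T) :: B) :=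
      ⟨by omega, hF, hFV, by omega, ⟨k, hGT (mem_insert_self _ _)⟩, hTF'.ssubset_of_ne hTF, hBT⟩
    have := step _ (by simp only [List.length_append, List.length_cons]; omega) ((hA _).1 hc)
    rw [(hA _).2.1, (hA _).2.2] at this
    rw [← this, monomial, monomial, hz, show i - 1 - q = i - (q + 1) by omega,
      show i - (i - 1) = 1 by omega]
    ring
  rw [hmon, hτ.mul_self_eq hGF.1 hFV.1 hk hkG hl hlF hzG hzF hzV, sum_congr rfl above,
    sum_congr rfl below, (hA _).2.1, weight_recursion B hGF.1 hFV.1 hk hkG hl hlF hqi]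
  push_cast
  rw [← sum_mul, ← sum_mul, ← mul_sum, ← mul_sum]
  ring

lemma isDivisorSystem_tauA (n : ℕ) : IsDivisorSystem (tauA n) where
  empty := dif_neg (by simp)
  univ := dif_neg (by simp)
  mul_eq_zero S T h₁ h₂ := by
    have hS : S.Nonempty ∧ S ≠ univ :=
      ⟨nonempty_iff_ne_empty.2 fun h => h₁ (by simp [h]), fun h => h₂ (by simp [h])⟩
    have hT : T.Nonempty ∧ T ≠ univ :=
      ⟨nonempty_iff_ne_empty.2 fun h => h₂ (by simp [h]), fun h => h₁ (by simp [h])⟩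
    rw [tauA, tauA, dif_pos hS, dif_pos hT, ← map_mul, Ideal.Quotient.eq_zero_iff_mem]
    exact Ideal.subset_span (.inl ⟨⟨S, hS⟩, ⟨T, hT⟩, h₁, h₂, rfl⟩)
  linear k l := by
    have key : ∀ (P : Finset (Fin (n + 1)) → Prop) [DecidablePred P],
        (∀ S, P S → S.Nonempty ∧ S ≠ univ) →
        ∑ S with P S, tauA n S = Ideal.Quotient.mk (Ideal.span (relA n))
          (∑ S : IdxA n, if P S.1 then X S else 0) := by
      intro P _ hP
      rw [map_sum, sum_filter, ← sum_subset (subset_univ (univ.filter fun S =>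
        S.Nonempty ∧ S ≠ univ)) fun S _ hS => if_neg fun h => hS (by simpa using hP S h)]
      rw [sum_subtype (p := fun S => S.Nonempty ∧ S ≠ univ) _ (by simp)]
      refine sum_congr rfl fun S _ => ?_
      split_ifs
      · exact dif_pos S.2
      · simp
    rw [key _ fun S h => ⟨⟨k, h.1⟩, fun e => h.2 (e ▸ mem_univ l)⟩,
      key _ fun S h => ⟨⟨l, h.2⟩, fun e => h.1 (e ▸ mem_univ k)⟩, Ideal.Quotient.eq]
    exact Ideal.subset_span (.inr ⟨k, l, rfl⟩)

lemma isFlagProd_initSeg (n m : ℕ) (hm : m ≤ n + 1) :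
    IsFlagProd (tauA n) (initSeg n m) (∏ i ∈ range m, tauA n (initSeg n i)) := by
  induction m with
  | zero => simpa [initSeg] using IsFlagProd.empty
  | succ m ih =>
    have he : (initSeg n (m + 1)).erase ⟨m, hm⟩ = initSeg n m := by
      ext x
      simp only [initSeg, mem_erase, mem_filter, mem_univ, true_and, ne_eq, Fin.ext_iff]
      omega
    have hmem : (⟨m, hm⟩ : Fin (n + 1)) ∈ initSeg n (m + 1) := by simp [initSeg]
    have := IsFlagProd.step hmem (he ▸ ih (by omega))
    rwa [he, mul_comm, ← prod_range_succ] at this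

lemma isFlagProd_ptA (n : ℕ) : IsFlagProd (tauA n) univ (ptA n) := by
  have h := isFlagProd_initSeg n (n + 1) le_rfl
  have hu : initSeg n (n + 1) = univ := by ext x; simp [initSeg, x.is_le]
  have h₀ : tauA n (initSeg n 0) = 1 := by simpa [initSeg] using (isDivisorSystem_tauA n).empty
  rw [hu, range_eq_Ico, prod_eq_prod_Ico_succ_bot (by omega), h₀, one_mul] at h
  exact h

/-- The corners of the diagram of a sequence of nested sets list the distinct sets among them,
together with the number of terms up to their last occurrence. -/
lemma chain_of_corners (τ : Finset α → R) {n : ℕ} {S : ℕ → Finset α}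
    (hne : ∀ i ∈ Icc 1 n, (S i).Nonempty)
    (hchain : ∀ i j, 1 ≤ i → i ≤ j → j ≤ n → S i ⊆ S j) (L : List ℕ) {p : ℕ} (hp : p ≤ n)
    {U : Finset α} (hU : p < n → S (n - p) ⊂ U) (hs : L.Pairwise (· < ·))
    (hmem : ∀ i, i ∈ L ↔ p < i ∧ i ≤ n ∧
      lamE n (fun i => (S (n + 1 - i)).card) (i + 1) <
        lamE n (fun i => (S (n + 1 - i)).card) i) :
    IsChainFrom n p U (L.map fun i => (i, S (n + 1 - i))) ∧
      monomial τ p (L.map fun i => (i, S (n + 1 - i))) = ∏ j ∈ Ioc p n, τ (S (n + 1 - j)) := by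
  induction L generalizing p U with
  | nil =>
    have hpn : p = n := by
      by_contra hpn
      have hpos := (hne 1 (by simp; omega)).card_pos
      exact List.not_mem_nil ((hmem n).2 ⟨by omega, le_rfl, by simpa [lamE] using hpos⟩)
    subst hpn
    simp [IsChainFrom, monomial]
  | cons i L ih =>
    rw [List.pairwise_cons] at hs
    obtain ⟨hpi, hin, hcorner⟩ := (hmem i).1 (by simp)
    have hconst : ∀ j, j ≤ i → p < j → S (n + 1 - j) = S (n + 1 - i) := by
      intro j hj
      induction hj using Nat.decreasingInduction with
      | self => exact fun _ => rfl
      | of_succ j hj ihj =>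
        intro hpj
        rw [← ihj (by omega)]
        have hnot : j ∉ i :: L := by
          simp only [List.mem_cons, not_or]
          exact ⟨by omega, fun h => by have := hs.1 j h; omega⟩
        rw [hmem] at hnot
        have hle := fun h => hnot ⟨hpj, by omega, h⟩
        simp only [lamE, if_pos (show j ≤ n by omega), if_pos (show j + 1 ≤ n by omega),
          imp_false, not_lt] at hle
        exact (eq_of_subset_of_card_le (hchain _ _ (by omega) (by omega) (by omega)) hle).symm
    have hss : i < n → S (n - i) ⊂ S (n + 1 - i) := by
      intro hi
      simp only [lamE, if_pos hin, if_pos (show i + 1 ≤ n by omega),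
        show n + 1 - (i + 1) = n - i by omega] at hcorner
      exact (hchain _ _ (by omega) (by omega) (by omega)).ssubset_of_ne
        fun h => hcorner.ne (congrArg card h)
    obtain ⟨h₁, h₂⟩ := ih hin hss hs.2 fun j => by
      constructor
      · intro h
        exact ⟨hs.1 j h, ((hmem j).1 (by simp [h])).2⟩
      · rintro ⟨hij, h⟩
        have := (hmem j).2 ⟨by omega, h⟩
        simp only [List.mem_cons] at this
        exact this.resolve_left (by omega)
    refine ⟨⟨hpi, hne _ (by simp; omega), ?_, h₁⟩, ?_⟩
    · rw [← hconst (p + 1) (by omega) (by omega), show n + 1 - (p + 1) = n - p by omega]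
      exact hU (by omega)
    · rw [List.map_cons, monomial, h₂, ← prod_Ioc_consecutive _ hpi.le hin]
      congr 1
      rw [prod_congr rfl fun j hj => by
        rw [hconst j (mem_Ioc.1 hj).2 (mem_Ioc.1 hj).1], prod_const, Nat.card_Ioc]

/-- The weight of a chain written as a product over consecutive triples of its indices. -/
lemma weight_map {n : ℕ} {lam : ℕ → ℕ} {S : ℕ → Finset α} (L : List ℕ) {p u : ℕ} {U : Finset α}
    (hL : IsChainFrom n p U (L.map fun i => (i, S i)))
    (hlam : ∀ i ∈ L, lamE n lam i = (S i).card) :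
    weight n p u (L.map fun i => (i, S i)) = (-1) ^ (n + p + L.length) *
      Cb (u - lamE n lam (L.getD 0 (n + 1)) - 1) (u + p - n - 1) *
      ∏ r ∈ range L.length,
        Cb (L.getD r (n + 1) - (p :: L).getD r (n + 1) - 1)
          (lamE n lam (L.getD r (n + 1)) + L.getD r (n + 1) - n - 1) *
        Cb (lamE n lam (L.getD r (n + 1)) - lamE n lam (L.getD (r + 1) (n + 1)) - 1)
          (lamE n lam (L.getD r (n + 1)) + L.getD r (n + 1) - n - 1) := by
  induction L generalizing p u U with
  | nil =>
    obtain rfl : p = n := hL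
    simp [weight, lamE, ← two_mul]
  | cons i L ih =>
    have hi := hlam i (by simp)
    rw [List.map_cons, weight, ih hL.2.2.2 fun j hj => hlam j (by simp [hj]), List.length_cons,
      prod_range_succ']
    simp only [List.getD_cons_zero, List.getD_cons_succ, hi]
    have hs : (-1 : ℤ) ^ (i + p + 1) * (-1) ^ (n + i + L.length) =
        (-1) ^ (n + p + (L.length + 1)) := by
      rw [← pow_add, show i + p + 1 + (n + i + L.length) = n + p + (L.length + 1) + 2 * i by ring,
        pow_add, pow_mul]
      simp
    rw [← hs]
    ring

lemma IY_eq_weight {n : ℕ} {lam : ℕ → ℕ} {S : ℕ → Finset α} {U : Finset α}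
    (hL : IsChainFrom n 0 U ((cornerL n lam).map fun i => (i, S i)))
    (hlam : ∀ i ∈ cornerL n lam, lamE n lam i = (S i).card)
    (hle : ∀ i ∈ cornerL n lam, lamE n lam i ≤ n) :
    IY n lam = weight n 0 (n + 1) ((cornerL n lam).map fun i => (i, S i)) := by
  have h₀ : Cb (((n + 1 : ℕ) : ℤ) - lamE n lam ((cornerL n lam).getD 0 (n + 1)) - 1)
      ((n + 1 : ℕ) + (0 : ℕ) - n - 1) = 1 := by
    have : lamE n lam ((cornerL n lam).getD 0 (n + 1)) ≤ n := by
      cases h : cornerL n lam with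
      | nil => simp [lamE]
      | cons i L => exact hle i (by simp [h])
    rw [show (((n + 1 : ℕ) : ℤ) + (0 : ℕ) - n - 1) = 0 by push_cast; ring,
      Cb_zero_right (by push_cast; omega)]
  rw [weight_map _ hL hlam, h₀, IY, sC, mul_one, add_zero]
  congr 1
  rw [← Ico_add_one_right_eq_Icc, prod_Ico_eq_prod_range, Nat.add_sub_cancel]
  refine prod_congr rfl fun r _ => ?_
  have hi : ∀ r, iC n lam (r + 1) = (cornerL n lam).getD r (n + 1) := fun r => by simp [iC]
  have hi' : iC n lam r = (0 :: cornerL n lam).getD r (n + 1) := by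
    cases r with
    | zero => simp [iC]
    | succ r => rw [hi, List.getD_cons_succ]
  rw [add_comm 1 r, yC, aC, bC, cC, hi, hi, Nat.add_sub_cancel, hi']

end WeylChamber

/-- For a chain `S_1 ⊆ … ⊆ S_n` of nonempty proper subsets of `[n+1]`,
with `λ_i = |S_{n+1−i}|`, one has `τ_{S_1} ⋯ τ_{S_n} = I(λ) · τ_{{1}} ⋯ τ_{{1,…,n}}` in `R_n`. -/
theorem typeA_intersection_formula (n : ℕ) (hn : 1 ≤ n)
    (S : ℕ → Finset (Fin (n + 1)))
    (hne : ∀ i ∈ Finset.Icc 1 n, (S i).Nonempty)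
    (hpr : ∀ i ∈ Finset.Icc 1 n, S i ≠ Finset.univ)
    (hchain : ∀ i j, 1 ≤ i → i ≤ j → j ≤ n → S i ⊆ S j) :
    (∏ i ∈ Finset.Icc 1 n, tauA n (S i)) =
      (IY n (fun i => (S (n + 1 - i)).card) : RA n) * ptA n := by
  classical
  set lam : ℕ → ℕ := fun i => (S (n + 1 - i)).card with hlam
  have hmem : ∀ i, i ∈ cornerL n lam ↔ 0 < i ∧ i ≤ n ∧ lamE n lam (i + 1) < lamE n lam i :=
    fun i => by simp [cornerL, Nat.succ_le_iff, and_assoc]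
  have hlamE : ∀ i ∈ cornerL n lam, lamE n lam i = (S (n + 1 - i)).card :=
    fun i hi => if_pos ((hmem i).1 hi).2.1
  have hproper : ∀ i ∈ Finset.Icc 1 n, S i ⊂ Finset.univ :=
    fun i hi => (Finset.subset_univ _).ssubset_of_ne (hpr i hi)
  obtain ⟨hL, hmon⟩ := WeylChamber.chain_of_corners (tauA n) hne hchain (cornerL n lam)
    (Nat.zero_le n) (fun _ => hproper _ (by simp; omega)) (Finset.sortedLT_sort _).pairwise hmem
  have hle : ∀ i ∈ cornerL n lam, lamE n lam i ≤ n := fun i hi => by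
    have hi' := (hmem i).1 hi
    have := Finset.card_lt_card (hproper (n + 1 - i) (by simp; omega))
    rw [hlamE i hi]
    simp only [Finset.card_univ, Fintype.card_fin] at this
    omega
  rw [WeylChamber.IY_eq_weight hL hlamE hle, ← WeylChamber.monomial_eq_weight_mul
    (WeylChamber.isDivisorSystem_tauA n) (by simp) (WeylChamber.isFlagProd_ptA n) hL, hmon]
  refine Finset.prod_bij' (fun i _ => n + 1 - i) (fun i _ => n + 1 - i) ?_ ?_ ?_ ?_ ?_
  · intro i hi; simp only [Finset.mem_Icc, Finset.mem_Ioc] at hi ⊢; omega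
  · intro i hi; simp only [Finset.mem_Icc, Finset.mem_Ioc] at hi ⊢; omega
  · intro i hi; simp only [Finset.mem_Icc] at hi; omega
  · intro i hi; simp only [Finset.mem_Ioc] at hi; omega
  · intro i hi
    simp only [Finset.mem_Icc] at hi
    rw [show n + 1 - (n + 1 - i) = i by omega]
end

section
/- Let S_1 ⊆ … ⊆ S_n and S'_1 ⊆ … ⊆ S'_n be two chains of nonempty proper subsets of [n+1] with |S_i| = |S'_i| for all i = 1,…,n. Then in R_n one has τ_{S_1}·τ_{S_2}⋯τ_{S_n} = τ_{S'_1}·τ_{S'_2}⋯τ_{S'_n}. -/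
open MvPolynomial

namespace TypeA

variable {n : ℕ}

/-- The class `τ_S` for a nonempty proper subset `S`. -/
noncomputable def tau (S : IdxA n) : RA n := Ideal.Quotient.mk _ (X S)

/-- The sum of the classes `τ_S` over all `S` containing `a` but not `b`. -/
noncomputable def sepSum (a b : Fin (n + 1)) : RA n :=
  ∑ S : IdxA n, if a ∈ S.1 ∧ b ∉ S.1 then tau S else 0

/-- The monomial `∏ τ_S` over a multiset of nonempty proper subsets. -/
noncomputable def mon (M : Multiset (IdxA n)) : RA n := (M.map tau).prod

lemma mon_cons (S : IdxA n) (M : Multiset (IdxA n)) : mon (S ::ₘ M) = tau S * mon M := by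
  simp [mon]

lemma tau_mul_tau_eq_zero {S T : IdxA n} (h₁ : ¬ S.1 ⊆ T.1) (h₂ : ¬ T.1 ⊆ S.1) :
    tau S * tau T = 0 := by
  rw [tau, tau, ← map_mul, Ideal.Quotient.eq_zero_iff_mem]
  exact Ideal.subset_span (Or.inl ⟨S, T, h₁, h₂, rfl⟩)

lemma sepSum_comm (a b : Fin (n + 1)) : sepSum a b = sepSum b a := by
  have h : Ideal.Quotient.mk (Ideal.span (relA n))
      ((∑ S : IdxA n, if a ∈ S.1 ∧ b ∉ S.1 then X S else 0) -
        (∑ S : IdxA n, if a ∉ S.1 ∧ b ∈ S.1 then X S else 0)) = 0 :=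
    Ideal.Quotient.eq_zero_iff_mem.2 (Ideal.subset_span (Or.inr ⟨a, b, rfl⟩))
  rw [map_sub, sub_eq_zero, map_sum, map_sum] at h
  simp only [apply_ite (Ideal.Quotient.mk (Ideal.span (relA n))), map_zero] at h
  simp only [sepSum, tau]
  rw [h]
  exact Finset.sum_congr rfl fun S _ => by simp only [and_comm]

/-- A permutation of `[n+1]` permutes the nonempty proper subsets. -/
def permIdx (σ : Equiv.Perm (Fin (n + 1))) : IdxA n ≃ IdxA n :=
  σ.finsetCongr.subtypeEquiv fun S => by
    have h : S.map σ.toEmbedding = Finset.univ ↔ S = Finset.univ := by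
      conv_lhs => rw [← Finset.map_univ_equiv σ, Finset.map_inj]
    simp [h]

lemma coe_permIdx (σ : Equiv.Perm (Fin (n + 1))) (S : IdxA n) :
    (permIdx σ S).1 = S.1.map σ.toEmbedding := rfl

lemma sum_permIdx (σ : Equiv.Perm (Fin (n + 1))) (a b : Fin (n + 1)) :
    (∑ S : IdxA n, if a ∈ S.1 ∧ b ∉ S.1 then tau (permIdx σ S) else 0) =
      sepSum (σ a) (σ b) := by
  rw [sepSum, ← Equiv.sum_comp (permIdx σ) fun S => if σ a ∈ S.1 ∧ σ b ∉ S.1 then tau S else 0]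
  simp [coe_permIdx]

/-- The ring endomorphism of `R_n` induced by a permutation of `[n+1]`. -/
noncomputable def act (σ : Equiv.Perm (Fin (n + 1))) : RA n →+* RA n :=
  Ideal.Quotient.lift _ (aeval (R := ℤ) fun S : IdxA n => tau (permIdx σ S)).toRingHom
    fun p hp => by
      rw [← RingHom.mem_ker]
      revert p
      change Ideal.span (relA n) ≤ _
      rw [Ideal.span_le]
      rintro _ (⟨S, T, h₁, h₂, rfl⟩ | ⟨a, b, rfl⟩)
      · simp only [SetLike.mem_coe, RingHom.mem_ker, AlgHom.toRingHom_eq_coe, RingHom.coe_coe,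
          map_mul, aeval_X]
        apply tau_mul_tau_eq_zero <;> simpa [coe_permIdx]
      · simp only [SetLike.mem_coe, RingHom.mem_ker, AlgHom.toRingHom_eq_coe, RingHom.coe_coe,
          map_sub, map_sum, apply_ite (aeval (R := ℤ) fun S : IdxA n => tau (permIdx σ S)),
          aeval_X, map_zero]
        rw [sum_permIdx, sub_eq_zero, sepSum_comm, ← sum_permIdx]
        exact Finset.sum_congr rfl fun S _ => by simp only [and_comm]

@[simp] lemma act_tau (σ : Equiv.Perm (Fin (n + 1))) (S : IdxA n) :
    act σ (tau S) = tau (permIdx σ S) := by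
  simp only [act, tau, Ideal.Quotient.lift_mk]
  simp

lemma act_sepSum (σ : Equiv.Perm (Fin (n + 1))) (a b : Fin (n + 1)) :
    act σ (sepSum a b) = sepSum (σ a) (σ b) := by
  rw [← sum_permIdx, sepSum, map_sum]
  simp [apply_ite (act σ)]

lemma act_mon (σ : Equiv.Perm (Fin (n + 1))) (M : Multiset (IdxA n)) :
    act σ (mon M) = mon (M.map (permIdx σ)) := by
  simp [mon, map_multiset_prod]

lemma permIdx_mul (σ π : Equiv.Perm (Fin (n + 1))) (S : IdxA n) :
    permIdx (σ * π) S = permIdx σ (permIdx π S) := by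
  apply Subtype.ext
  simp only [coe_permIdx, Finset.map_map]
  rfl

lemma act_mul_mon (σ π : Equiv.Perm (Fin (n + 1))) (M : Multiset (IdxA n)) :
    act (σ * π) (mon M) = act σ (act π (mon M)) := by
  simp only [act_mon, Multiset.map_map]
  congr 2
  funext S
  exact permIdx_mul σ π S

lemma permIdx_swap_of_iff {a b : Fin (n + 1)} {S : IdxA n} (h : a ∈ S.1 ↔ b ∈ S.1) :
    permIdx (Equiv.swap a b) S = S := by
  apply Subtype.ext
  ext x
  rw [coe_permIdx, Finset.mem_map_equiv, Equiv.symm_swap]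
  rcases eq_or_ne x a with rfl | hxa
  · rw [Equiv.swap_apply_left, h]
  rcases eq_or_ne x b with rfl | hxb
  · rw [Equiv.swap_apply_right, h]
  rw [Equiv.swap_apply_of_ne_of_ne hxa hxb]

/-- The members of `M` are pairwise comparable. -/
def IsChainM (M : Multiset (IdxA n)) : Prop :=
  ∀ S ∈ M, ∀ T ∈ M, S.1 ⊆ T.1 ∨ T.1 ⊆ S.1

lemma mon_eq_zero_of_not_isChainM {M : Multiset (IdxA n)} (h : ¬ IsChainM M) : mon M = 0 := by
  simp only [IsChainM, not_forall, not_or] at h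
  obtain ⟨S, hS, T, hT, h₁, h₂⟩ := h
  obtain ⟨N, rfl⟩ := Multiset.exists_cons_of_mem hS
  have hne : T ≠ S := fun e => h₁ (e ▸ subset_rfl)
  obtain ⟨L, rfl⟩ := Multiset.exists_cons_of_mem ((Multiset.mem_cons.1 hT).resolve_left hne)
  rw [mon_cons, mon_cons, ← mul_assoc, tau_mul_tau_eq_zero h₁ h₂, zero_mul]

lemma IsChainM.of_cons {S : IdxA n} {M : Multiset (IdxA n)} (h : IsChainM (S ::ₘ M)) :
    IsChainM M := fun A hA B hB =>
  h A (Multiset.mem_cons_of_mem hA) B (Multiset.mem_cons_of_mem hB)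

lemma isChainM_cons {S : IdxA n} {M : Multiset (IdxA n)} :
    IsChainM (S ::ₘ M) ↔ (∀ T ∈ M, S.1 ⊆ T.1 ∨ T.1 ⊆ S.1) ∧ IsChainM M := by
  refine ⟨fun h => ⟨fun T hT => h S (Multiset.mem_cons_self _ _) T (Multiset.mem_cons_of_mem hT),
    h.of_cons⟩, fun ⟨h₁, h₂⟩ A hA B hB => ?_⟩
  rcases Multiset.mem_cons.1 hA with rfl | hA <;> rcases Multiset.mem_cons.1 hB with rfl | hB
  · exact Or.inl subset_rfl
  · exact h₁ _ hB
  · exact (h₁ A ‹_›).symm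
  · exact h₂ _ hA _ hB

lemma IsChainM.card_le {M : Multiset (IdxA n)} (h : IsChainM M) (hd : M.Nodup) :
    Multiset.card M ≤ n := by
  rw [← Multiset.toFinset_card_of_nodup hd]
  have := Finset.card_le_card_of_injOn (s := M.toFinset) (t := Finset.Icc 1 n)
    (fun S => S.1.card) ?_ ?_
  · simpa using this
  · intro S _
    have h₁ := S.2.1.card_pos
    have h₂ := Finset.card_lt_card (Finset.ssubset_univ_iff.2 S.2.2)
    simp only [Finset.card_univ, Fintype.card_fin] at h₂
    simp only [Finset.coe_Icc, Set.mem_Icc]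
    omega
  · intro S hS T hT e
    simp only [Finset.mem_coe, Multiset.mem_toFinset] at hS hT
    dsimp only at e
    apply Subtype.ext
    rcases h S hS T hT with h | h
    · exact Finset.eq_of_subset_of_card_le h e.ge
    · exact (Finset.eq_of_subset_of_card_le h e.le).symm

lemma sepSum_mul (a b : Fin (n + 1)) (x : RA n) :
    sepSum a b * x = ∑ S : IdxA n, if a ∈ S.1 ∧ b ∉ S.1 then tau S * x else 0 := by
  simp [sepSum, Finset.sum_mul, ite_mul]

/-- If a full flag separates `a` and `b` exactly once, its monomial is `sepSum a b` times the
product of the remaining classes. -/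
lemma sepSum_mul_mon {a b : Fin (n + 1)} {T : IdxA n} {N : Multiset (IdxA n)}
    (hc : IsChainM (T ::ₘ N)) (hd : (T ::ₘ N).Nodup) (hn : Multiset.card (T ::ₘ N) = n)
    (haT : a ∈ T.1) (hbT : b ∉ T.1) (hN : ∀ S ∈ N, a ∈ S.1 ↔ b ∈ S.1) :
    sepSum a b * mon N = mon (T ::ₘ N) := by
  rw [sepSum_mul, Finset.sum_eq_single T]
  · rw [if_pos ⟨haT, hbT⟩, mon_cons]
  · rintro U - hUT
    split_ifs with hU
    swap
    · rfl
    obtain ⟨haU, hbU⟩ := hU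
    rw [← mon_cons]
    apply mon_eq_zero_of_not_isChainM
    intro hcU
    rw [isChainM_cons] at hc hcU
    let V : IdxA n := ⟨T.1 ∩ U.1, ⟨a, Finset.mem_inter.2 ⟨haT, haU⟩⟩, fun e =>
      hbT (Finset.mem_inter.1 (e ▸ Finset.mem_univ b)).1⟩
    have haV : a ∈ V.1 := Finset.mem_inter.2 ⟨haT, haU⟩
    have hbV : b ∉ V.1 := fun h => hbT (Finset.mem_inter.1 h).1
    have hVN : IsChainM (V ::ₘ N) := by
      refine isChainM_cons.2 ⟨fun S hS => ?_, hc.2⟩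
      rcases hc.1 S hS with h | h
      · exact Or.inl (Finset.inter_subset_left.trans h)
      rcases hcU.1 S hS with h' | h'
      · exact Or.inl (Finset.inter_subset_right.trans h')
      · exact Or.inr (Finset.subset_inter h h')
    have hVnot : V ∉ N := fun h => hbV ((hN V h).1 haV)
    have hUnot : U ∉ N := fun h => hbU ((hN U h).1 haU)
    have hTnot : T ∉ N := fun h => hbT ((hN T h).1 haT)
    have hNd : N.Nodup := (Multiset.nodup_cons.1 hd).2
    have key : ∀ W : IdxA n, W ∉ N → W ≠ V → V.1 ⊆ W.1 →
        (∀ S ∈ N, W.1 ⊆ S.1 ∨ S.1 ⊆ W.1) → False := by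
      intro W hWN hWV hVW hW
      have h₁ : IsChainM (W ::ₘ V ::ₘ N) := by
        refine isChainM_cons.2 ⟨fun S hS => ?_, hVN⟩
        rcases Multiset.mem_cons.1 hS with rfl | hS
        · exact Or.inr hVW
        · exact hW S hS
      have h₂ : (W ::ₘ V ::ₘ N).Nodup := by
        simp [hWN, hWV, hVnot, hNd]
      have := h₁.card_le h₂
      simp only [Multiset.card_cons] at this hn
      omega
    by_cases hTV : T = V
    · refine key U hUnot (fun e => hUT (e.trans hTV.symm)) Finset.inter_subset_right hcU.1
    · exact key T hTnot hTV Finset.inter_subset_left hc.1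
  · simp

lemma act_swap_mon_of_single {a b : Fin (n + 1)} {T : IdxA n} {N : Multiset (IdxA n)}
    (hc : IsChainM (T ::ₘ N)) (hd : (T ::ₘ N).Nodup) (hn : Multiset.card (T ::ₘ N) = n)
    (haT : a ∈ T.1) (hbT : b ∉ T.1) (hN : ∀ S ∈ N, a ∈ S.1 ↔ b ∈ S.1) :
    act (Equiv.swap a b) (mon (T ::ₘ N)) = mon (T ::ₘ N) := by
  rw [← sepSum_mul_mon hc hd hn haT hbT hN, map_mul, act_sepSum, Equiv.swap_apply_left,
    Equiv.swap_apply_right, sepSum_comm, act_mon,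
    Multiset.map_congr rfl fun S hS => permIdx_swap_of_iff (hN S hS), Multiset.map_id']

/-- The members of `M` containing exactly one of `a` and `b`. -/
def separators (M : Multiset (IdxA n)) (a b : Fin (n + 1)) : Finset (IdxA n) :=
  M.toFinset.filter fun S => ¬ (a ∈ S.1 ↔ b ∈ S.1)

lemma mem_separators {M : Multiset (IdxA n)} {a b : Fin (n + 1)} {S : IdxA n} :
    S ∈ separators M a b ↔ S ∈ M ∧ ¬ (a ∈ S.1 ↔ b ∈ S.1) := by
  simp [separators]

lemma separators_comm (M : Multiset (IdxA n)) (a b : Fin (n + 1)) :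
    separators M a b = separators M b a := by
  ext S
  rw [mem_separators, mem_separators, iff_comm (a := a ∈ S.1)]

/-- If two members of a chain separate `a` from `b`, an element between them is separated from
both `a` and `b` by strictly fewer members. -/
lemma exists_separators_ssubset {M : Multiset (IdxA n)} (hc : IsChainM M) {a b : Fin (n + 1)}
    {T U : IdxA n} (hT : T ∈ M) (hU : U ∈ M) (hTU : T.1 ⊂ U.1) (haT : a ∈ T.1) (hbU : b ∉ U.1) :
    ∃ c, c ≠ a ∧ c ≠ b ∧ separators M a c ⊂ separators M a b ∧
      separators M c b ⊂ separators M a b := by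
  obtain ⟨c, hcU, hcT⟩ := Finset.exists_of_ssubset hTU
  have haU := hTU.1 haT
  have hbT : b ∉ T.1 := fun h => hbU (hTU.1 h)
  refine ⟨c, fun e => hcT (e ▸ haT), fun e => hbU (e ▸ hcU), ?_, ?_⟩
  · refine Finset.ssubset_iff_subset_ne.2 ⟨fun S hS => ?_, fun e => ?_⟩
    · obtain ⟨hSM, hS⟩ := mem_separators.1 hS
      refine mem_separators.2 ⟨hSM, fun h => hS ⟨fun ha => ?_, fun hcS => ?_⟩⟩
      · rcases hc S hSM U hU with h' | h'
        · exact absurd (h' (h.1 ha)) hbU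
        · exact h' hcU
      · rcases hc S hSM T hT with h' | h'
        · exact absurd (h' hcS) hcT
        · exact h' haT
    · have : U ∈ separators M a c := e ▸ mem_separators.2 ⟨hU, by simp [haU, hbU]⟩
      exact (mem_separators.1 this).2 (by simp [haU, hcU])
  · refine Finset.ssubset_iff_subset_ne.2 ⟨fun S hS => ?_, fun e => ?_⟩
    · obtain ⟨hSM, hS⟩ := mem_separators.1 hS
      refine mem_separators.2 ⟨hSM, fun h => hS ⟨fun hcS => ?_, fun hb => ?_⟩⟩
      · rcases hc S hSM T hT with h' | h'
        · exact absurd (h' hcS) hcT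
        · exact h.1 (h' haT)
      · rcases hc S hSM U hU with h' | h'
        · exact absurd (h' hb) hbU
        · exact h' hcU
    · have : T ∈ separators M c b := e ▸ mem_separators.2 ⟨hT, by simp [haT, hbT]⟩
      exact (mem_separators.1 this).2 (by simp [hcT, hbT])

lemma act_swap_mon_of_nodup {M : Multiset (IdxA n)} (hc : IsChainM M) (hd : M.Nodup)
    (hn : Multiset.card M = n) (a b : Fin (n + 1)) :
    act (Equiv.swap a b) (mon M) = mon M := by
  induction h : (separators M a b).card using Nat.strong_induction_on generalizing a b with
  | _ d ih =>
    by_cases hM : ∀ S ∈ M, a ∈ S.1 ↔ b ∈ S.1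
    · rw [act_mon, Multiset.map_congr rfl fun S hS => permIdx_swap_of_iff (hM S hS),
        Multiset.map_id']
    push Not at hM
    obtain ⟨T, hT, hsep⟩ := hM
    wlog haT : a ∈ T.1 generalizing a b
    · rw [Equiv.swap_comm]
      exact this b a (by rw [separators_comm, h]) (by tauto) (by tauto)
    have hbT : b ∉ T.1 := by tauto
    obtain ⟨N, rfl⟩ := Multiset.exists_cons_of_mem hT
    by_cases hN : ∀ S ∈ N, a ∈ S.1 ↔ b ∈ S.1
    · exact act_swap_mon_of_single hc hd hn haT hbT hN
    push Not at hN
    obtain ⟨U, hUN, hU⟩ := hN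
    have hUM : U ∈ T ::ₘ N := Multiset.mem_cons_of_mem hUN
    have hne : T ≠ U := fun e => (Multiset.nodup_cons.1 hd).1 (e ▸ hUN)
    have hne' : T.1 ≠ U.1 := fun e => hne (Subtype.ext e)
    have hUab : a ∈ U.1 ∧ b ∉ U.1 := by
      rcases hc T hT U hUM with h' | h'
      · have := h' haT
        tauto
      · have : b ∉ U.1 := fun hb => hbT (h' hb)
        tauto
    obtain ⟨c, hca, hcb, h₁, h₂⟩ : ∃ c, c ≠ a ∧ c ≠ b ∧
        separators (T ::ₘ N) a c ⊂ separators (T ::ₘ N) a b ∧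
        separators (T ::ₘ N) c b ⊂ separators (T ::ₘ N) a b := by
      rcases hc T hT U hUM with h' | h'
      · exact exists_separators_ssubset hc hT hUM (h'.ssubset_of_ne hne') haT hUab.2
      · exact exists_separators_ssubset hc hUM hT (h'.ssubset_of_ne hne'.symm) hUab.1 hbT
    have hab : a ≠ b := fun e => hbT (e ▸ haT)
    have e₁ := ih _ (h ▸ Finset.card_lt_card h₁) a c rfl
    have e₂ := ih _ (h ▸ Finset.card_lt_card h₂) c b rfl
    rw [← Equiv.swap_mul_swap_mul_swap hcb.symm hab.symm, act_mul_mon,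
      Equiv.swap_comm b c, Equiv.swap_comm c a, e₁, act_mul_mon, e₂, e₁]

lemma act_mon_of_nodup {M : Multiset (IdxA n)} (hd : M.Nodup)
    (hn : Multiset.card M = n) (σ : Equiv.Perm (Fin (n + 1))) :
    act σ (mon M) = mon M := by
  by_cases hc : IsChainM M
  · induction σ using Equiv.Perm.swap_induction_on with
    | one =>
      rw [act_mon, Multiset.map_congr rfl (g := id), Multiset.map_id]
      intro S _
      exact Subtype.ext Finset.map_refl
    | swap_mul f x y _ ih =>
      rw [act_mul_mon, ih, act_swap_mon_of_nodup hc hd hn]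
  · rw [mon_eq_zero_of_not_isChainM hc, map_zero]

lemma exists_mem_notMem_of_ssubset (S : IdxA n) {N : Multiset (IdxA n)} (hc : IsChainM N) :
    ∃ a ∈ S.1, ∀ T ∈ N, T.1 ⊂ S.1 → a ∉ T.1 := by
  let F := N.toFinset.filter fun T => T.1 ⊂ S.1
  rcases F.eq_empty_or_nonempty with hF | hF
  · obtain ⟨a, ha⟩ := S.2.1
    refine ⟨a, ha, fun T hT hTS => ?_⟩
    have : T ∈ F := Finset.mem_filter.2 ⟨Multiset.mem_toFinset.2 hT, hTS⟩
    simp [hF] at this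
  · obtain ⟨U, hU, hmax⟩ := F.exists_max_image (fun T => T.1.card) hF
    simp only [F, Finset.mem_filter, Multiset.mem_toFinset] at hU hmax
    obtain ⟨a, haS, haU⟩ := Finset.exists_of_ssubset hU.2
    refine ⟨a, haS, fun T hT hTS haT => haU ?_⟩
    rcases hc T hT U hU.1 with h | h
    · exact h haT
    · exact (Finset.eq_of_subset_of_card_le h (hmax T ⟨hT, hTS⟩)) ▸ haT

lemma exists_notMem_mem_of_ssubset (S : IdxA n) {N : Multiset (IdxA n)} (hc : IsChainM N) :
    ∃ b ∉ S.1, ∀ T ∈ N, S.1 ⊂ T.1 → b ∈ T.1 := by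
  let F := N.toFinset.filter fun T => S.1 ⊂ T.1
  rcases F.eq_empty_or_nonempty with hF | hF
  · obtain ⟨b, -, hb⟩ := Finset.exists_of_ssubset (Finset.ssubset_univ_iff.2 S.2.2)
    refine ⟨b, hb, fun T hT hTS => ?_⟩
    have : T ∈ F := Finset.mem_filter.2 ⟨Multiset.mem_toFinset.2 hT, hTS⟩
    simp [hF] at this
  · obtain ⟨U, hU, hmin⟩ := F.exists_min_image (fun T => T.1.card) hF
    simp only [F, Finset.mem_filter, Multiset.mem_toFinset] at hU hmin
    obtain ⟨b, hbU, hbS⟩ := Finset.exists_of_ssubset hU.2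
    refine ⟨b, hbS, fun T hT hTS => ?_⟩
    rcases hc T hT U hU.1 with h | h
    · exact (Finset.eq_of_subset_of_card_le h (hmin T ⟨hT, hTS⟩)) ▸ hbU
    · exact h hbU

/-- A monomial with a repeated factor is minus a sum of monomials with more distinct factors. -/
lemma mon_cons_cons_eq {S : IdxA n} {N : Multiset (IdxA n)} (hc : IsChainM (S ::ₘ N)) :
    ∃ P : Finset (IdxA n), (∀ T ∈ P, T ∉ S ::ₘ N) ∧
      mon (S ::ₘ S ::ₘ N) = -∑ T ∈ P, mon (T ::ₘ S ::ₘ N) := by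
  have hcN := (isChainM_cons.1 hc).2
  obtain ⟨a, haS, ha⟩ := exists_mem_notMem_of_ssubset S hcN
  obtain ⟨b, hbS, hb⟩ := exists_notMem_mem_of_ssubset S hcN
  have h0 : sepSum b a * mon (S ::ₘ N) = 0 := by
    rw [sepSum_mul]
    refine Finset.sum_eq_zero fun T _ => ?_
    split_ifs with hT
    · rw [mon_cons, ← mul_assoc, tau_mul_tau_eq_zero (fun h => hbS (h hT.1))
        (fun h => hT.2 (h haS)), zero_mul]
    · rfl
  rw [sepSum_comm, sepSum_mul, ← Finset.sum_filter, ← Finset.add_sum_erase _ _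
    (Finset.mem_filter.2 ⟨Finset.mem_univ S, haS, hbS⟩)] at h0
  refine ⟨_, fun T hT hTN => ?_, by simpa only [mon_cons] using eq_neg_of_add_eq_zero_left h0⟩
  obtain ⟨hTS, hT⟩ := Finset.mem_erase.1 hT
  obtain ⟨-, haT, hbT⟩ := Finset.mem_filter.1 hT
  have hTN' := (Multiset.mem_cons.1 hTN).resolve_left hTS
  have hne : T.1 ≠ S.1 := fun e => hTS (Subtype.ext e)
  rcases (isChainM_cons.1 hc).1 T hTN' with h | h
  · exact hbT (hb T hTN' (h.ssubset_of_ne hne.symm))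
  · exact ha T hTN' (h.ssubset_of_ne hne) haT

/-- Permutations act trivially on monomials of top degree. -/
lemma act_mon_eq_self {M : Multiset (IdxA n)} (hn : Multiset.card M = n)
    (σ : Equiv.Perm (Fin (n + 1))) : act σ (mon M) = mon M := by
  induction h : n - M.toFinset.card using Nat.strong_induction_on generalizing M with
  | _ d ih =>
    by_cases hd : M.Nodup
    · exact act_mon_of_nodup hd hn σ
    by_cases hc : IsChainM M
    swap
    · rw [mon_eq_zero_of_not_isChainM hc, map_zero]
    have hlt : M.toFinset.card < n :=
      lt_of_le_of_ne ((Multiset.toFinset_card_le M).trans_eq hn)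
        fun e => hd (Multiset.toFinset_card_eq_card_iff_nodup.1 (e.trans hn.symm))
    obtain ⟨S, hS⟩ : ∃ S, 1 < M.count S := by
      rw [Multiset.nodup_iff_count_le_one] at hd
      push Not at hd
      exact hd
    obtain ⟨N, rfl⟩ : ∃ N, M = S ::ₘ S ::ₘ N := by
      obtain ⟨N, hN⟩ := Multiset.le_iff_exists_add.1 (Multiset.le_count_iff_replicate_le.1 hS)
      exact ⟨N, by simpa [Multiset.replicate_succ] using hN⟩
    obtain ⟨P, hP, e⟩ := mon_cons_cons_eq hc.of_cons
    rw [e, map_neg, map_sum]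
    refine congrArg _ (Finset.sum_congr rfl fun T hT => ih _ ?_ (by simpa using hn) rfl)
    have h₁ : (T ::ₘ S ::ₘ N).toFinset.card = (S ::ₘ S ::ₘ N).toFinset.card + 1 := by
      rw [Multiset.toFinset_cons, Finset.card_insert_of_notMem (by simpa using hP T hT)]
      simp
    omega

/-- Two chains of finite sets with equal cardinalities differ by a permutation. -/
lemma exists_perm_map_eq {α : Type*} [Fintype α] [DecidableEq α] {m : ℕ} {S S' : ℕ → Finset α}
    (hS : ∀ i j, 1 ≤ i → i ≤ j → j ≤ m → S i ⊆ S j)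
    (hS' : ∀ i j, 1 ≤ i → i ≤ j → j ≤ m → S' i ⊆ S' j)
    (hcard : ∀ i ∈ Finset.Icc 1 m, (S i).card = (S' i).card) :
    ∃ σ : Equiv.Perm α, ∀ i ∈ Finset.Icc 1 m, (S i).map σ.toEmbedding = S' i := by
  let f : (ℕ → Finset α) → α → ℕ := fun S x => ((Finset.Icc 1 m).filter fun i => x ∉ S i).card
  have hf : ∀ S : ℕ → Finset α, (∀ i j, 1 ≤ i → i ≤ j → j ≤ m → S i ⊆ S j) →
      ∀ i ∈ Finset.Icc 1 m, ∀ x, x ∈ S i ↔ f S x < i := by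
    intro S hS i hi x
    rw [Finset.mem_Icc] at hi
    constructor
    · intro hx
      have : (Finset.Icc 1 m).filter (fun j => x ∉ S j) ⊆ Finset.Ico 1 i := by
        intro j hj
        simp only [Finset.mem_filter, Finset.mem_Icc] at hj
        rw [Finset.mem_Ico]
        refine ⟨hj.1.1, lt_of_not_ge fun hij => hj.2 (hS i j hi.1 hij hj.1.2 hx)⟩
      have := Finset.card_le_card this
      simp only [Nat.card_Ico] at this
      simp only [f]
      omega
    · intro hx
      by_contra hxi
      have : Finset.Icc 1 i ⊆ (Finset.Icc 1 m).filter fun j => x ∉ S j := by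
        intro j hj
        simp only [Finset.mem_filter, Finset.mem_Icc] at hj ⊢
        exact ⟨⟨hj.1, hj.2.trans hi.2⟩, fun h => hxi (hS j i hj.1 hj.2 hi.2 h)⟩
      have := Finset.card_le_card this
      simp only [Nat.card_Icc] at this
      simp only [f] at hx
      omega
  have hle : ∀ (S : ℕ → Finset α) x, f S x ≤ m := fun S x =>
    (Finset.card_filter_le _ _).trans (by simp)
  have hlt : ∀ c, (Finset.univ.filter fun x => f S x < c).card =
      (Finset.univ.filter fun x => f S' x < c).card := by
    intro c
    rcases Nat.eq_zero_or_pos c with rfl | hc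
    · simp
    rcases le_or_gt c m with hcm | hcm
    · have hmem := Finset.mem_Icc.2 ⟨hc, hcm⟩
      simpa [← hf S hS c hmem, ← hf S' hS' c hmem] using hcard c hmem
    · rw [Finset.filter_true_of_mem fun x _ => (hle S x).trans_lt hcm,
        Finset.filter_true_of_mem fun x _ => (hle S' x).trans_lt hcm]
  have hfib : ∀ c, Fintype.card {x // f S x = c} = Fintype.card {x // f S' x = c} := by
    have key : ∀ (S : ℕ → Finset α) c, (Finset.univ.filter fun x => f S x < c + 1).card =
        (Finset.univ.filter fun x => f S x < c).card +
          (Finset.univ.filter fun x => f S x = c).card := by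
      intro S c
      rw [← Finset.card_union_of_disjoint, ← Finset.filter_or]
      · simp only [Order.lt_add_one_iff, le_iff_lt_or_eq]
      · exact Finset.disjoint_filter.2 fun x _ h => h.ne
    intro c
    rw [Fintype.card_subtype, Fintype.card_subtype]
    have h₁ := key S c
    have h₂ := key S' c
    rw [hlt, hlt c] at h₁
    omega
  let σ : Equiv.Perm α := Equiv.ofFiberEquiv fun c => Fintype.equivOfCardEq (hfib c)
  have hσ : ∀ x, f S' (σ x) = f S x := fun x => Equiv.ofFiberEquiv_map _ x
  refine ⟨σ, fun i hi => ?_⟩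
  ext y
  rw [Finset.mem_map_equiv, hf S hS i hi, hf S' hS' i hi, ← hσ, Equiv.apply_symm_apply]

end TypeA

/-- For two chains `S_1 ⊆ … ⊆ S_n` and `S'_1 ⊆ … ⊆ S'_n` of nonempty proper
subsets of `[n+1]` with `|S_i| = |S'_i|` for all `i`, one has
`τ_{S_1} ⋯ τ_{S_n} = τ_{S'_1} ⋯ τ_{S'_n}` in `R_n`. -/
theorem typeA_invariance (n : ℕ) (hn : 1 ≤ n)
    (S S' : ℕ → Finset (Fin (n + 1)))
    (hne : ∀ i ∈ Finset.Icc 1 n, (S i).Nonempty)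
    (hpr : ∀ i ∈ Finset.Icc 1 n, S i ≠ Finset.univ)
    (hchain : ∀ i j, 1 ≤ i → i ≤ j → j ≤ n → S i ⊆ S j)
    (hne' : ∀ i ∈ Finset.Icc 1 n, (S' i).Nonempty)
    (hpr' : ∀ i ∈ Finset.Icc 1 n, S' i ≠ Finset.univ)
    (hchain' : ∀ i j, 1 ≤ i → i ≤ j → j ≤ n → S' i ⊆ S' j)
    (hcard : ∀ i ∈ Finset.Icc 1 n, (S i).card = (S' i).card) :
    (∏ i ∈ Finset.Icc 1 n, tauA n (S i)) = ∏ i ∈ Finset.Icc 1 n, tauA n (S' i) := by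
  obtain ⟨σ, hσ⟩ := TypeA.exists_perm_map_eq hchain hchain' hcard
  have hidx : ∀ i : Finset.Icc 1 n, (S i).Nonempty ∧ S i ≠ Finset.univ :=
    fun i => ⟨hne i i.2, hpr i i.2⟩
  have hidx' : ∀ i : Finset.Icc 1 n, (S' i).Nonempty ∧ S' i ≠ Finset.univ :=
    fun i => ⟨hne' i i.2, hpr' i i.2⟩
  have hM := TypeA.act_mon_eq_self (n := n)
    (M := (Finset.Icc 1 n).attach.val.map fun i : Finset.Icc 1 n => ⟨S i, hidx i⟩)
    (by rw [Multiset.card_map, Finset.card_val, Finset.card_attach, Nat.card_Icc,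
      Nat.add_sub_cancel]) σ
  have h₁ : (∏ i ∈ Finset.Icc 1 n, tauA n (S i)) =
      TypeA.mon ((Finset.Icc 1 n).attach.val.map fun i : Finset.Icc 1 n => ⟨S i, hidx i⟩) := by
    rw [← Finset.prod_attach, TypeA.mon, Multiset.map_map]
    exact Finset.prod_congr rfl fun i _ => dif_pos (hidx i)
  have h₂ : (∏ i ∈ Finset.Icc 1 n, tauA n (S' i)) =
      TypeA.mon ((Finset.Icc 1 n).attach.val.map fun i : Finset.Icc 1 n => ⟨S' i, hidx' i⟩) := by
    rw [← Finset.prod_attach, TypeA.mon, Multiset.map_map]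
    exact Finset.prod_congr rfl fun i _ => dif_pos (hidx' i)
  rw [h₁, h₂, ← hM, TypeA.act_mon, Multiset.map_map]
  congr 1
  exact Multiset.map_congr rfl fun i _ => Subtype.ext (hσ i i.2)
end

section
/- Let A, B, C be subsets of [n+1] with ∅ ⊆ A ⊊ B ⊊ C ⊆ [n+1], and let b ∈ B∖A and c ∈ C∖B. Then in R_n (with the convention τ_∅ = τ_{[n+1]} = 1) one has τ_A·τ_B²·τ_C = − Σ τ_A·τ_B·τ_{B'}·τ_C, where the sum runs over all subsets B' of [n+1] with A ⊊ B' ⊊ C, B' ≠ B, b ∈ B', and c ∉ B'. -/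
open MvPolynomial

theorem tauA_mul_eq_zero (n : ℕ) {S T : Finset (Fin (n + 1))} (hST : ¬ S ⊆ T) (hTS : ¬ T ⊆ S) :
    tauA n S * tauA n T = 0 := by
  have hS : S.Nonempty ∧ S ≠ Finset.univ := by
    refine ⟨Finset.nonempty_iff_ne_empty.2 ?_, ?_⟩
    · rintro rfl; exact hST (Finset.empty_subset _)
    · rintro rfl; exact hTS (Finset.subset_univ _)
  have hT : T.Nonempty ∧ T ≠ Finset.univ := by
    refine ⟨Finset.nonempty_iff_ne_empty.2 ?_, ?_⟩
    · rintro rfl; exact hTS (Finset.empty_subset _)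
    · rintro rfl; exact hST (Finset.subset_univ _)
  rw [tauA, tauA, dif_pos hS, dif_pos hT, ← map_mul]
  exact Ideal.Quotient.eq_zero_iff_mem.2
    (Ideal.subset_span (Or.inl ⟨⟨S, hS⟩, ⟨T, hT⟩, hST, hTS, rfl⟩))

theorem mk_sum_X_eq_sum_tauA (n : ℕ) (p : Finset (Fin (n + 1)) → Prop) [DecidablePred p]
    (hp : ∀ S, p S → S.Nonempty ∧ S ≠ Finset.univ) :
    Ideal.Quotient.mk (Ideal.span (relA n)) (∑ S : IdxA n, if p S.1 then X S else 0) =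
      ∑ S : Finset (Fin (n + 1)), if p S then tauA n S else 0 := by
  rw [map_sum]
  refine Finset.sum_of_injOn Subtype.val Subtype.val_injective.injOn (by simp) ?_ ?_
  · intro S _ hS
    refine if_neg fun h => hS ?_
    exact ⟨⟨S, hp S h⟩, by simp, rfl⟩
  · rintro ⟨S, hS⟩ _
    by_cases h : p S <;> simp [h, tauA, hS.1, hS.2]

theorem sum_tauA_separating_comm (n : ℕ) (k l : Fin (n + 1)) :
    (∑ S : Finset (Fin (n + 1)), if k ∈ S ∧ l ∉ S then tauA n S else 0) =
      ∑ S : Finset (Fin (n + 1)), if k ∉ S ∧ l ∈ S then tauA n S else 0 := by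
  rw [← mk_sum_X_eq_sum_tauA n (fun S => k ∈ S ∧ l ∉ S) fun S h =>
      ⟨⟨k, h.1⟩, fun hS => h.2 (hS ▸ Finset.mem_univ l)⟩,
    ← mk_sum_X_eq_sum_tauA n (fun S => k ∉ S ∧ l ∈ S) fun S h =>
      ⟨⟨l, h.2⟩, fun hS => h.1 (hS ▸ Finset.mem_univ k)⟩]
  exact Ideal.Quotient.eq.2 (Ideal.subset_span (Or.inr ⟨k, l, rfl⟩))

/-- separation lemma. For `∅ ⊆ A ⊊ B ⊊ C ⊆ [n+1]`, `b ∈ B∖A`, `c ∈ C∖B`,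
one has (with the convention `τ_∅ = τ_{[n+1]} = 1`)
`τ_A τ_B² τ_C = − Σ_{A ⊊ B' ⊊ C, B' ≠ B, b ∈ B', c ∉ B'} τ_A τ_B τ_{B'} τ_C` in `R_n`. -/
theorem typeA_separation (n : ℕ) (hn : 1 ≤ n)
    (A B C : Finset (Fin (n + 1))) (hAB : A ⊂ B) (hBC : B ⊂ C)
    (b : Fin (n + 1)) (hb : b ∈ B \ A) (c : Fin (n + 1)) (hc : c ∈ C \ B) :
    tauA n A * tauA n B ^ 2 * tauA n C =
      - ∑ B' : Finset (Fin (n + 1)),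
          if A ⊂ B' ∧ B' ⊂ C ∧ B' ≠ B ∧ b ∈ B' ∧ c ∉ B' then
            tauA n A * tauA n B * tauA n B' * tauA n C
          else 0 := by
  obtain ⟨hbB, hbA⟩ := Finset.mem_sdiff.1 hb
  obtain ⟨hcC, hcB⟩ := Finset.mem_sdiff.1 hc
  have key := congrArg (tauA n A * tauA n B * tauA n C * ·) (sum_tauA_separating_comm n b c)
  simp only [Finset.mul_sum] at key
  rw [Finset.sum_eq_zero (s := Finset.univ)
      (f := fun S => _ * if b ∉ S ∧ c ∈ S then tauA n S else 0),
    ← Finset.add_sum_erase _ _ (Finset.mem_univ B), if_pos ⟨hbB, hcB⟩] at key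
  · refine eq_neg_iff_add_eq_zero.2 (Eq.trans ?_ key)
    congr 1
    · ring
    rw [← Finset.add_sum_erase _ _ (Finset.mem_univ B), if_neg (by simp), zero_add]
    refine Finset.sum_congr rfl fun S hS => ?_
    have hSB := Finset.ne_of_mem_erase hS
    by_cases h : b ∈ S ∧ c ∉ S
    · have hSA : ¬ S ⊆ A := fun h' => hbA (h' h.1)
      have hCS : ¬ C ⊆ S := fun h' => h.2 (h' hcC)
      rw [if_pos h]
      by_cases hAS : A ⊆ S
      · by_cases hSC : S ⊆ C
        · rw [if_pos ⟨⟨hAS, hSA⟩, ⟨hSC, hCS⟩, hSB, h⟩]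
          ring
        · rw [if_neg fun h' => hSC h'.2.1.1]
          linear_combination (-(tauA n A * tauA n B)) * tauA_mul_eq_zero n hSC hCS
      · rw [if_neg fun h' => hAS h'.1.1]
        linear_combination (-(tauA n B * tauA n C)) * tauA_mul_eq_zero n hAS hSA
    · rw [if_neg h, if_neg fun h' => h h'.2.2.2, mul_zero]
  · intro S _
    split_ifs with h
    · linear_combination (tauA n A * tauA n C) *
        tauA_mul_eq_zero n (fun h' => h.1 (h' hbB) : ¬ B ⊆ S) fun h' => hcB (h' h.2)
    · exact mul_zero _
end

section
/- Let u, v, w be permutations of [n+1] with d(u) + d(v) = d(w). Consider the family of n subsets of [n+1] (with multiplicity) consisting of u[i] for each descent i of u, v[i] for each descent i of v, and w[i] for each ascent i of w. If this family can be ordered into a chain S_1 ⊆ S_2 ⊆ … ⊆ S_n, then in R_n one has (∏_{i a descent of u} τ_{u[i]})·(∏_{i a descent of v} τ_{v[i]})·(∏_{i an ascent of w} τ_{w[i]}) = I(λ_{u,v}^w) · τ_{{1}}·τ_{{1,2}}⋯τ_{{1,…,n}}, where λ_{u,v}^w is the Young diagram consisting of the cardinalities |S_1|,…,|S_n| ordered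 as a weakly decreasing sequence. If the family cannot be ordered into a chain, then the left-hand side equals 0 in R_n. -/
open MvPolynomial

/-- The value `u(i) ∈ {1,…,n+1}` of the permutation `u` at the (1-indexed) position `i`. -/
def pval (n : ℕ) (u : Equiv.Perm (Fin (n + 1))) (i : ℕ) : ℕ :=
  if h : i - 1 < n + 1 then (u ⟨i - 1, h⟩ : ℕ) + 1 else 0

/-- The set of descents of `u`: those `i ∈ [n]` with `u(i) > u(i+1)`. -/
def descents (n : ℕ) (u : Equiv.Perm (Fin (n + 1))) : Finset ℕ :=
  (Finset.Icc 1 n).filter (fun i => pval n u (i + 1) < pval n u i)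

/-- The set of ascents of `u`: those `i ∈ [n]` which are not descents. -/
def ascents (n : ℕ) (u : Equiv.Perm (Fin (n + 1))) : Finset ℕ :=
  (Finset.Icc 1 n).filter (fun i => ¬ pval n u (i + 1) < pval n u i)

/-- The subset `u[i] = {u(1),…,u(i)}` of `[n+1]`. -/
def pSet (n : ℕ) (u : Equiv.Perm (Fin (n + 1))) (i : ℕ) : Finset (Fin (n + 1)) :=
  (Finset.univ.filter (fun k : Fin (n + 1) => (k : ℕ) < i)).image (fun k => u k)

namespace PermutohedralRing

section Ring

variable {n : ℕ}

lemma tauA_empty : tauA n ∅ = 1 := by simp [tauA]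

lemma tauA_univ : tauA n Finset.univ = 1 := by simp [tauA]

lemma tauA_mul_of_not_subset {S T : Finset (Fin (n + 1))} (h₁ : ¬ S ⊆ T) (h₂ : ¬ T ⊆ S) :
    tauA n S * tauA n T = 0 := by
  have hS : S.Nonempty ∧ S ≠ Finset.univ :=
    ⟨Finset.nonempty_iff_ne_empty.2 fun h => h₁ (by simp [h]), fun h => h₂ (by simp [h])⟩
  have hT : T.Nonempty ∧ T ≠ Finset.univ :=
    ⟨Finset.nonempty_iff_ne_empty.2 fun h => h₂ (by simp [h]), fun h => h₁ (by simp [h])⟩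
  rw [tauA, tauA, dif_pos hS, dif_pos hT, ← map_mul, Ideal.Quotient.eq_zero_iff_mem]
  exact Ideal.subset_span (Or.inl ⟨⟨S, hS⟩, ⟨T, hT⟩, h₁, h₂, rfl⟩)

lemma sum_tauA_eq_sum_idxA (p : Finset (Fin (n + 1)) → Prop) [DecidablePred p]
    (hp : ∀ S, p S → S.Nonempty ∧ S ≠ Finset.univ) :
    ∑ S with p S, tauA n S =
      Ideal.Quotient.mk (Ideal.span (relA n)) (∑ S : IdxA n, if p S.1 then X S else 0) := by
  rw [Finset.sum_filter, map_sum]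
  refine (Finset.sum_of_injOn (Subtype.val : IdxA n → _) Subtype.val_injective.injOn (by simp)
    (fun S _ hS => ?_) fun S _ => ?_).symm
  · rw [if_neg]
    exact fun h => hS (by simpa using hp S h)
  · by_cases h : p S.1
    · rw [if_pos h, if_pos h, tauA, dif_pos S.2]
    · rw [if_neg h, if_neg h, map_zero]

/-- The linear relation attached to a pair `k, l`. -/
lemma sum_tauA_separating (k l : Fin (n + 1)) :
    ∑ S with k ∈ S ∧ l ∉ S, tauA n S = ∑ S with k ∉ S ∧ l ∈ S, tauA n S := by
  rw [sum_tauA_eq_sum_idxA _ fun S h => ⟨⟨k, h.1⟩, fun e => h.2 (by simp [e])⟩,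
    sum_tauA_eq_sum_idxA _ fun S h => ⟨⟨l, h.2⟩, fun e => h.1 (by simp [e])⟩,
    Ideal.Quotient.eq]
  exact Ideal.subset_span (Or.inr ⟨k, l, rfl⟩)

lemma tauA_mul_sum_filter (A : Finset (Fin (n + 1))) (p q : Finset (Fin (n + 1)) → Prop)
    [DecidablePred p] [DecidablePred q] (hqp : ∀ S, q S → p S)
    (hpq : ∀ S, p S → ¬ q S → ¬ A ⊆ S ∧ ¬ S ⊆ A) :
    tauA n A * ∑ S with p S, tauA n S = tauA n A * ∑ S with q S, tauA n S := by
  rw [Finset.mul_sum, Finset.mul_sum]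
  symm
  refine Finset.sum_subset (fun S hS => ?_) fun S hS hS' => ?_
  · simpa using hqp S (by simpa using hS)
  · have := hpq S (by simpa using hS) (by simpa using hS')
    exact tauA_mul_of_not_subset this.1 this.2

/-- The sum of the `τ_S` over `S ⊋ A` avoiding `l`. -/
noncomputable def betaAt (A : Finset (Fin (n + 1))) (l : Fin (n + 1)) : RA n :=
  ∑ S with A ⊂ S ∧ l ∉ S, tauA n S

/-- The sum of the `τ_S` over `S ⊊ B` containing `k`. -/
noncomputable def alphaAt (B : Finset (Fin (n + 1))) (k : Fin (n + 1)) : RA n :=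
  ∑ S with S ⊂ B ∧ k ∈ S, tauA n S

lemma tauA_mul_betaAt_comm {A : Finset (Fin (n + 1))} {k l : Fin (n + 1)} (hk : k ∉ A)
    (hl : l ∉ A) : tauA n A * betaAt A k = tauA n A * betaAt A l := by
  have h (k l : Fin (n + 1)) (hk : k ∉ A) : tauA n A * ∑ S with k ∈ S ∧ l ∉ S, tauA n S =
      tauA n A * ∑ S with (A ⊂ S ∧ l ∉ S) ∧ k ∈ S, tauA n S :=
    tauA_mul_sum_filter A _ _ (by tauto) fun S h₁ h₂ => by
      have : ¬ S ⊆ A := fun h => hk (h h₁.1)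
      refine ⟨fun h => h₂ ⟨⟨⟨h, this⟩, h₁.2⟩, h₁.1⟩, this⟩
  have h' (k l : Fin (n + 1)) : betaAt A l = ∑ S with (A ⊂ S ∧ l ∉ S) ∧ k ∈ S, tauA n S +
      ∑ S with (A ⊂ S ∧ l ∉ S) ∧ k ∉ S, tauA n S := by
    rw [betaAt, ← Finset.sum_filter_add_sum_filter_not _ (fun S => k ∈ S),
      Finset.filter_filter, Finset.filter_filter]
  rw [h' l k, h' k l, mul_add, mul_add, ← h l k hl, ← h k l hk, sum_tauA_separating l k]
  congr 3
  · ext S; simp [and_comm]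
  · ext S; simp [and_right_comm]

lemma tauA_mul_alphaAt_comm {B : Finset (Fin (n + 1))} {k l : Fin (n + 1)} (hk : k ∈ B)
    (hl : l ∈ B) : tauA n B * alphaAt B k = tauA n B * alphaAt B l := by
  have h (k l : Fin (n + 1)) (hl : l ∈ B) : tauA n B * ∑ S with k ∈ S ∧ l ∉ S, tauA n S =
      tauA n B * ∑ S with (S ⊂ B ∧ k ∈ S) ∧ l ∉ S, tauA n S :=
    tauA_mul_sum_filter B _ _ (by tauto) fun S h₁ h₂ => by
      have : ¬ B ⊆ S := fun h => h₁.2 (h hl)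
      refine ⟨this, fun h => h₂ ⟨⟨⟨h, this⟩, h₁.1⟩, h₁.2⟩⟩
  have h' (k l : Fin (n + 1)) : alphaAt B k = ∑ S with (S ⊂ B ∧ k ∈ S) ∧ l ∉ S, tauA n S +
      ∑ S with (S ⊂ B ∧ k ∈ S) ∧ l ∈ S, tauA n S := by
    rw [alphaAt, ← Finset.sum_filter_not_add_sum_filter _ (fun S => l ∈ S),
      Finset.filter_filter, Finset.filter_filter]
  rw [h' l k, h' k l, mul_add, mul_add, ← h l k hk, ← h k l hl, sum_tauA_separating l k]
  congr 3
  · ext S; simp [and_comm]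
  · ext S; simp [and_right_comm]

/-- A class representing `Σ_{S ⊋ A, l ∉ S} τ_S`, which modulo the annihilator of `τ_A` does
not depend on `l ∉ A`. -/
noncomputable def beta (A : Finset (Fin (n + 1))) : RA n :=
  open Classical in if h : ∃ l, l ∉ A then betaAt A h.choose else 0

/-- A class representing `Σ_{S ⊊ B, k ∈ S} τ_S`, which modulo the annihilator of `τ_B` does not
depend on `k ∈ B`. -/
noncomputable def alpha (B : Finset (Fin (n + 1))) : RA n :=
  open Classical in if h : ∃ k, k ∈ B then alphaAt B h.choose else 0

lemma tauA_mul_beta {A : Finset (Fin (n + 1))} {l : Fin (n + 1)} (hl : l ∉ A) :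
    tauA n A * beta A = tauA n A * betaAt A l := by
  have h : ∃ l, l ∉ A := ⟨l, hl⟩
  rw [beta, dif_pos h]
  exact tauA_mul_betaAt_comm h.choose_spec hl

lemma tauA_mul_alpha {B : Finset (Fin (n + 1))} {k : Fin (n + 1)} (hk : k ∈ B) :
    tauA n B * alpha B = tauA n B * alphaAt B k := by
  have h : ∃ k, k ∈ B := ⟨k, hk⟩
  rw [alpha, dif_pos h]
  exact tauA_mul_alphaAt_comm h.choose_spec hk

/-- The self-intersection formula. -/
lemma tauA_mul_self {A : Finset (Fin (n + 1))} (hA : A.Nonempty) (hA' : A ≠ Finset.univ) :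
    tauA n A * tauA n A = tauA n A * -(alpha A + beta A) := by
  obtain ⟨k, hk⟩ := hA
  obtain ⟨l, hl⟩ : ∃ l, l ∉ A := by
    by_contra! h
    exact hA' (Finset.eq_univ_iff_forall.2 h)
  have h0 : tauA n A * ∑ S with k ∉ S ∧ l ∈ S, tauA n S = 0 := by
    rw [tauA_mul_sum_filter A _ (fun _ => False) (by simp)
      fun S hS _ => ⟨fun h => hS.1 (h hk), fun h => hl (h hS.2)⟩]
    simp
  have h1 : tauA n A * ∑ S with k ∈ S ∧ l ∉ S, tauA n S =
      tauA n A * ∑ S with S = A ∨ ((S ⊂ A ∧ k ∈ S) ∨ (A ⊂ S ∧ l ∉ S)), tauA n S := by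
    refine tauA_mul_sum_filter A _ _ ?_ ?_
    · rintro S (rfl | h | h)
      · exact ⟨hk, hl⟩
      · exact ⟨h.2, fun h' => hl (h.1.1 h')⟩
      · exact ⟨h.1.1 hk, h.2⟩
    · intro S h₁ h₂
      push Not at h₂
      refine ⟨fun h => ?_, fun h => ?_⟩
      · exact h₁.2 (h₂.2.2 (h.ssubset_of_ne h₂.1.symm))
      · exact h₂.2.1 (h.ssubset_of_ne h₂.1) h₁.1
  rw [← sum_tauA_separating, h1, Finset.filter_or, Finset.sum_union, Finset.filter_or,
    Finset.sum_union] at h0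
  · have hα := tauA_mul_alpha hk
    have hβ := tauA_mul_beta hl
    rw [alphaAt] at hα
    rw [betaAt] at hβ
    simp only [Finset.filter_eq', Finset.mem_univ, if_true, Finset.sum_singleton] at h0
    linear_combination h0 + hα + hβ
  · rw [Finset.disjoint_filter]
    exact fun S _ h h' => h.1.2 h'.1.1
  · rw [Finset.disjoint_filter]
    rintro S _ rfl (h | h)
    · exact h.1.2 subset_rfl
    · exact h.1.2 subset_rfl

lemma tauA_mul_beta_of_mem {A B : Finset (Fin (n + 1))} {l : Fin (n + 1)} (hl : l ∉ A)
    (hlB : l ∈ B) : tauA n A * tauA n B * beta A =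
      ∑ S with A ⊂ S ∧ S ⊂ B ∧ l ∉ S, tauA n A * tauA n B * tauA n S := by
  rw [mul_right_comm, tauA_mul_beta hl, mul_right_comm, mul_assoc, betaAt,
    tauA_mul_sum_filter B _ (fun S => A ⊂ S ∧ S ⊂ B ∧ l ∉ S) (by tauto), ← mul_assoc,
    Finset.mul_sum]
  intro S h₁ h₂
  have : ¬ B ⊆ S := fun h => h₁.2 (h hlB)
  exact ⟨this, fun h => h₂ ⟨h₁.1, ⟨h, this⟩, h₁.2⟩⟩

lemma tauA_mul_alpha_of_notMem {A B : Finset (Fin (n + 1))} {k : Fin (n + 1)} (hk : k ∉ A)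
    (hkB : k ∈ B) : tauA n A * tauA n B * alpha B =
      ∑ S with A ⊂ S ∧ S ⊂ B ∧ k ∈ S, tauA n A * tauA n B * tauA n S := by
  rw [mul_assoc, tauA_mul_alpha hkB, mul_left_comm, alphaAt,
    tauA_mul_sum_filter A _ (fun S => A ⊂ S ∧ S ⊂ B ∧ k ∈ S) (by tauto), ← mul_assoc,
    mul_comm (tauA n B), Finset.mul_sum]
  intro S h₁ h₂
  have : ¬ S ⊆ A := fun h => hk (h h₁.2)
  exact ⟨fun h => h₂ ⟨⟨h, this⟩, h₁⟩, this⟩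

lemma tauA_mul_beta_pow_eq_zero {q : ℕ} {A B : Finset (Fin (n + 1))} (hAB : A ⊂ B)
    (hq : B.card ≤ A.card + q) : tauA n A * tauA n B * beta A ^ q = 0 := by
  induction q generalizing B with
  | zero => exact absurd (Finset.card_lt_card hAB) (by omega)
  | succ q ih =>
    obtain ⟨l, hlB, hl⟩ := Finset.exists_of_ssubset hAB
    rw [pow_succ', ← mul_assoc, tauA_mul_beta_of_mem hl hlB, Finset.sum_mul]
    refine Finset.sum_eq_zero fun S hS => ?_
    simp only [Finset.mem_filter, Finset.mem_univ, true_and] at hS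
    have := Finset.card_lt_card hS.2.1
    linear_combination tauA n B * ih hS.1 (by omega)

lemma tauA_mul_alpha_pow_eq_zero {p : ℕ} {A B : Finset (Fin (n + 1))} (hAB : A ⊂ B)
    (hp : B.card ≤ A.card + p) : tauA n A * tauA n B * alpha B ^ p = 0 := by
  induction p generalizing A with
  | zero => exact absurd (Finset.card_lt_card hAB) (by omega)
  | succ p ih =>
    obtain ⟨k, hkB, hk⟩ := Finset.exists_of_ssubset hAB
    rw [pow_succ', ← mul_assoc, tauA_mul_alpha_of_notMem hk hkB, Finset.sum_mul]
    refine Finset.sum_eq_zero fun S hS => ?_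
    simp only [Finset.mem_filter, Finset.mem_univ, true_and] at hS
    have := Finset.card_lt_card hS.1
    linear_combination tauA n A * ih hS.2.1 (by omega)

lemma tauA_mul_beta_pow_mul_alpha_pow_eq_zero {p q : ℕ} {A B : Finset (Fin (n + 1))}
    (hAB : A ⊂ B) (hpq : B.card ≤ A.card + p + q) :
    tauA n A * tauA n B * beta A ^ q * alpha B ^ p = 0 := by
  cases p with
  | zero => rw [tauA_mul_beta_pow_eq_zero hAB (by omega), zero_mul]
  | succ p =>
    obtain ⟨k, hkB, hk⟩ := Finset.exists_of_ssubset hAB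
    rw [pow_succ', mul_right_comm, ← mul_assoc, tauA_mul_alpha_of_notMem hk hkB, Finset.sum_mul,
      Finset.sum_mul]
    refine Finset.sum_eq_zero fun S hS => ?_
    simp only [Finset.mem_filter, Finset.mem_univ, true_and] at hS
    by_cases h : S.card ≤ A.card + q
    · linear_combination tauA n B * alpha B ^ p * tauA_mul_beta_pow_eq_zero hS.1 h
    · linear_combination
        tauA n A * beta A ^ q * tauA_mul_alpha_pow_eq_zero (p := p) hS.2.1 (by omega)

/-- The product of the `τ_S` over a full flag of nonempty sets ending in `A`. -/
noncomputable def flagProd (A : Finset (Fin (n + 1))) : RA n :=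
  if h : A.Nonempty then flagProd (A.erase (A.max' h)) * tauA n A else 1
termination_by A.card
decreasing_by exact Finset.card_erase_lt_of_mem (A.max'_mem h)

lemma flagProd_empty : flagProd (∅ : Finset (Fin (n + 1))) = 1 := by
  rw [flagProd, dif_neg (by simp)]

lemma exists_flagProd_eq (A : Finset (Fin (n + 1))) : ∃ x, flagProd A = x * tauA n A := by
  by_cases h : A.Nonempty
  · exact ⟨_, by rw [flagProd, dif_pos h]⟩
  · rw [Finset.not_nonempty_iff_eq_empty.1 h]
    exact ⟨1, by rw [flagProd_empty, tauA_empty, one_mul]⟩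

lemma tauA_wall_crossing {A : Finset (Fin (n + 1))} {k l : Fin (n + 1)} (hk : k ∉ A) (hl : l ∉ A)
    (hkl : k ≠ l) : tauA n A * tauA n (insert k A) * tauA n (insert l (insert k A)) =
      tauA n A * tauA n (insert l A) * tauA n (insert l (insert k A)) := by
  have h (k l : Fin (n + 1)) (hk : k ∉ A) (hl : l ∉ A) (hkl : k ≠ l) :
      tauA n A * tauA n (insert l (insert k A)) * ∑ S with k ∈ S ∧ l ∉ S, tauA n S =
      tauA n A * tauA n (insert l (insert k A)) * tauA n (insert k A) := by
    rw [mul_assoc, tauA_mul_sum_filter _ _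
      (fun S => k ∈ S ∧ l ∉ S ∧ S ⊆ insert l (insert k A)) (by tauto), mul_left_comm,
      tauA_mul_sum_filter _ _ (fun S => S = insert k A), Finset.filter_eq']
    · simp only [Finset.mem_univ, if_true, Finset.sum_singleton]; ring
    · rintro S rfl
      simp [hl, hkl.symm]
    · rintro S ⟨h₁, h₂, h₃⟩ h₄
      refine ⟨fun h => h₄ (subset_antisymm ?_ (Finset.insert_subset h₁ h)), fun h => hk (h h₁)⟩
      intro x hx
      refine (Finset.mem_insert.1 (h₃ hx)).resolve_left ?_
      rintro rfl
      exact h₂ hx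
    · intro S h₁ h₂
      refine ⟨fun h => h₁.2 (h (by simp)), fun h => h₂ ⟨h₁.1, h₁.2, h⟩⟩
  have h1 := h k l hk hl hkl
  have h2 := h l k hl hk hkl.symm
  rw [Finset.insert_comm k l] at h2
  rw [sum_tauA_separating] at h2
  have h3 : ∑ S with l ∉ S ∧ k ∈ S, tauA n S = ∑ S with k ∈ S ∧ l ∉ S, tauA n S := by
    simp only [and_comm]
  rw [h3] at h2
  linear_combination h2 - h1

lemma flagProd_erase {A : Finset (Fin (n + 1))} {l : Fin (n + 1)} (hl : l ∈ A) :
    flagProd A = flagProd (A.erase l) * tauA n A := by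
  induction A using Finset.strongInduction generalizing l with
  | H A ih =>
    have h : A.Nonempty := ⟨l, hl⟩
    rw [flagProd, dif_pos h]
    set k := A.max' h with hk
    have hkA : k ∈ A := A.max'_mem h
    by_cases hkl : l = k
    · rw [hkl]
    · have hlk : l ∈ A.erase k := Finset.mem_erase.2 ⟨hkl, hl⟩
      have hkl' : k ∈ A.erase l := Finset.mem_erase.2 ⟨fun h => hkl h.symm, hkA⟩
      have hc : (A.erase k).erase l = (A.erase l).erase k := Finset.erase_right_comm
      rw [ih _ (Finset.erase_ssubset hkA) hlk, ih _ (Finset.erase_ssubset hl) hkl', hc]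
      obtain ⟨x, hx⟩ := exists_flagProd_eq ((A.erase l).erase k)
      have hw := tauA_wall_crossing (A := (A.erase l).erase k) (k := k) (l := l) (by simp)
        (by simp) (fun h => hkl h.symm)
      rw [Finset.insert_erase hkl', Finset.insert_erase hl, ← hc,
        Finset.insert_erase hlk, hc] at hw
      rw [hx]
      linear_combination -x * hw

lemma flagProd_insert {A : Finset (Fin (n + 1))} {l : Fin (n + 1)} (hl : l ∉ A) :
    flagProd (insert l A) = flagProd A * tauA n (insert l A) := by
  rw [flagProd_erase (Finset.mem_insert_self l A), Finset.erase_insert hl]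

lemma flagProd_mul_eq_zero {A B : Finset (Fin (n + 1))} {x : RA n}
    (h : tauA n A * tauA n B * x = 0) : flagProd A * tauA n B * x = 0 := by
  obtain ⟨y, hy⟩ := exists_flagProd_eq A
  rw [hy]
  linear_combination y * h

lemma flagProd_mul_beta_of_mem {A B : Finset (Fin (n + 1))} {l : Fin (n + 1)} (hl : l ∉ A)
    (hlB : l ∈ B) : flagProd A * tauA n B * beta A =
      ∑ S with A ⊂ S ∧ S ⊂ B ∧ l ∉ S, flagProd A * tauA n B * tauA n S := by
  obtain ⟨y, hy⟩ := exists_flagProd_eq A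
  simp only [hy, mul_assoc y]
  rw [tauA_mul_beta_of_mem hl hlB, Finset.mul_sum]

lemma flagProd_mul_alpha_of_notMem {A B : Finset (Fin (n + 1))} {k : Fin (n + 1)} (hk : k ∉ A)
    (hkB : k ∈ B) : flagProd A * tauA n B * alpha B =
      ∑ S with A ⊂ S ∧ S ⊂ B ∧ k ∈ S, flagProd A * tauA n B * tauA n S := by
  obtain ⟨y, hy⟩ := exists_flagProd_eq A
  simp only [hy, mul_assoc y]
  rw [tauA_mul_alpha_of_notMem hk hkB, Finset.mul_sum]

lemma flagProd_mul_tauA_of_card {A B : Finset (Fin (n + 1))} (hAB : A ⊂ B)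
    (h : B.card = A.card + 1) : flagProd A * tauA n B = flagProd B := by
  obtain ⟨l, hlB, hl⟩ := Finset.exists_of_ssubset hAB
  have : insert l A = B := Finset.eq_of_subset_of_card_le (Finset.insert_subset hlB hAB.1)
    (by rw [Finset.card_insert_of_notMem hl, h])
  rw [← this, flagProd_insert hl]

lemma flagProd_mul_beta_pow {q : ℕ} {A B : Finset (Fin (n + 1))} (hAB : A ⊂ B)
    (hq : B.card = A.card + q + 1) : flagProd A * tauA n B * beta A ^ q = flagProd B := by
  induction q generalizing B with
  | zero => rw [pow_zero, mul_one, flagProd_mul_tauA_of_card hAB (by omega)]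
  | succ q ih =>
    obtain ⟨l, hlB, hl⟩ := Finset.exists_of_ssubset hAB
    have hcard := Finset.card_erase_of_mem hlB
    have hsub : A ⊂ B.erase l := Finset.ssubset_iff_subset_ne.2
      ⟨Finset.subset_erase.2 ⟨hAB.1, hl⟩, fun h => by rw [← h] at hcard; omega⟩
    rw [pow_succ', ← mul_assoc, flagProd_mul_beta_of_mem hl hlB, Finset.sum_mul,
      Finset.sum_eq_single (B.erase l)]
    · rw [flagProd_erase hlB]
      linear_combination tauA n B * ih hsub (by omega)
    · intro S hS hSl
      simp only [Finset.mem_filter, Finset.mem_univ, true_and] at hS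
      have := Finset.card_lt_card
        ((Finset.subset_erase.2 ⟨hS.2.1.1, hS.2.2⟩).ssubset_of_ne hSl)
      linear_combination tauA n B *
        flagProd_mul_eq_zero (tauA_mul_beta_pow_eq_zero (q := q) hS.1 (by omega))
    · intro h
      exact (h (by simp [hsub, Finset.erase_ssubset hlB])).elim

lemma flagProd_mul_alpha_pow {p : ℕ} {A B : Finset (Fin (n + 1))} (hAB : A ⊂ B)
    (hp : B.card = A.card + p + 1) : flagProd A * tauA n B * alpha B ^ p = flagProd B := by
  induction p generalizing A with
  | zero => rw [pow_zero, mul_one, flagProd_mul_tauA_of_card hAB (by omega)]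
  | succ p ih =>
    obtain ⟨k, hkB, hk⟩ := Finset.exists_of_ssubset hAB
    have hcard := Finset.card_insert_of_notMem hk
    have hsub : insert k A ⊂ B := Finset.ssubset_iff_subset_ne.2
      ⟨Finset.insert_subset hkB hAB.1, fun h => by rw [h] at hcard; omega⟩
    rw [pow_succ', ← mul_assoc, flagProd_mul_alpha_of_notMem hk hkB, Finset.sum_mul,
      Finset.sum_eq_single (insert k A)]
    · rw [← ih hsub (by omega), flagProd_insert hk]
      ring
    · intro S hS hSk
      simp only [Finset.mem_filter, Finset.mem_univ, true_and] at hS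
      have := Finset.card_lt_card
        ((Finset.insert_subset hS.2.2 hS.1.1).ssubset_of_ne hSk.symm)
      linear_combination flagProd A *
        tauA_mul_alpha_pow_eq_zero (p := p) hS.2.1 (by omega)
    · intro h
      exact (h (by simp [hsub, Finset.ssubset_insert hk])).elim

lemma card_intermediate {A B : Finset (Fin (n + 1))} {k : Fin (n + 1)} (hk : k ∉ A) (hkB : k ∈ B)
    (hAB : A ⊆ B) (p q : ℕ) (h : B.card = A.card + (p + 1) + q + 1) :
    (Finset.univ.filter fun S => (A ⊂ S ∧ S ⊂ B ∧ k ∈ S) ∧ S.card = A.card + q + 1).card =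
      (p + 1 + q).choose q := by
  have hcard : ((B \ A).erase k).card = p + 1 + q := by
    rw [Finset.card_erase_of_mem (by simp [hk, hkB]), Finset.card_sdiff_of_subset hAB]
    omega
  rw [← hcard, ← Finset.card_powersetCard]
  refine Finset.card_nbij' (fun S => (S \ A).erase k) (fun U => A ∪ insert k U) ?_ ?_ ?_ ?_
  · intro S hS
    simp only [Finset.coe_filter, Finset.mem_univ, true_and, Set.mem_ofPred_eq] at hS
    simp only [Finset.mem_coe, Finset.mem_powersetCard]
    refine ⟨Finset.erase_subset_erase _ (Finset.sdiff_subset_sdiff hS.1.2.1.1 subset_rfl), ?_⟩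
    rw [Finset.card_erase_of_mem (by simp [hk, hS.1.2.2]), Finset.card_sdiff_of_subset hS.1.1.1]
    omega
  · intro U hU
    simp only [Finset.mem_coe, Finset.mem_powersetCard] at hU
    have hkU : k ∉ U := fun h => by simpa using hU.1 h
    have hd : Disjoint A (insert k U) := by
      rw [Finset.disjoint_insert_right]
      refine ⟨hk, Finset.disjoint_right.2 fun x hx => ?_⟩
      have := hU.1 hx
      simp at this
      exact this.2.2
    have hc : (A ∪ insert k U).card = A.card + q + 1 := by
      rw [Finset.card_union_of_disjoint hd, Finset.card_insert_of_notMem hkU, hU.2, add_assoc]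
    have hs : A ∪ insert k U ⊆ B := Finset.union_subset hAB (Finset.insert_subset hkB
      fun x hx => by have := hU.1 hx; simp at this; exact this.2.1)
    simp only [Finset.coe_filter, Finset.mem_univ, true_and, Set.mem_ofPred_eq]
    refine ⟨⟨?_, ?_, by simp⟩, hc⟩
    · exact Finset.subset_union_left.ssubset_of_ne fun h => hk (by rw [h]; simp)
    · exact hs.ssubset_of_ne fun h' => by rw [h'] at hc; omega
  · intro S hS
    simp only [Finset.coe_filter, Finset.mem_univ, true_and, Set.mem_ofPred_eq] at hS
    simp only
    rw [Finset.insert_erase (by simp [hk, hS.1.2.2]), Finset.union_sdiff_of_subset hS.1.1.1]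
  · intro U hU
    simp only [Finset.mem_coe, Finset.mem_powersetCard] at hU
    ext x
    have := @hU.1 x
    simp only [Finset.mem_erase, Finset.mem_sdiff, Finset.mem_union, Finset.mem_insert] at this ⊢
    tauto

/-- The evaluation of a product of powers of `beta A` and `alpha B` on the block between `A` and
`B`. -/
lemma flagProd_mul_beta_pow_mul_alpha_pow {p q : ℕ} {A B : Finset (Fin (n + 1))} (hAB : A ⊂ B)
    (h : B.card = A.card + p + q + 1) :
    flagProd A * tauA n B * beta A ^ q * alpha B ^ p = ((p + q).choose q : RA n) * flagProd B := by
  cases p with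
  | zero => rw [flagProd_mul_beta_pow hAB (by omega)]; simp
  | succ p =>
    obtain ⟨k, hkB, hk⟩ := Finset.exists_of_ssubset hAB
    rw [pow_succ', mul_right_comm, ← mul_assoc, flagProd_mul_alpha_of_notMem hk hkB,
      Finset.sum_mul, Finset.sum_mul]
    have key : ∀ S ∈ Finset.univ.filter fun S => A ⊂ S ∧ S ⊂ B ∧ k ∈ S,
        flagProd A * tauA n B * tauA n S * alpha B ^ p * beta A ^ q =
          if S.card = A.card + q + 1 then flagProd B else 0 := by
      intro S hS
      simp only [Finset.mem_filter, Finset.mem_univ, true_and] at hS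
      split_ifs with hc
      · rw [← flagProd_mul_alpha_pow (p := p) hS.2.1 (by omega),
          ← flagProd_mul_beta_pow (q := q) hS.1 hc]
        ring
      · by_cases hlt : S.card ≤ A.card + q
        · linear_combination tauA n B * alpha B ^ p *
            flagProd_mul_eq_zero (tauA_mul_beta_pow_eq_zero hS.1 hlt)
        · linear_combination flagProd A * beta A ^ q *
            tauA_mul_alpha_pow_eq_zero (p := p) hS.2.1 (by omega)
    rw [Finset.sum_congr rfl key, ← Finset.sum_filter, Finset.filter_filter, Finset.sum_const,
      card_intermediate hk hkB hAB.1 p q h, nsmul_eq_mul]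

lemma tauA_pow_succ {B : Finset (Fin (n + 1))} (hB : B.Nonempty) (hB' : B ≠ Finset.univ) (d : ℕ) :
    tauA n B ^ (d + 1) = ∑ p ∈ Finset.range (d + 1),
      (-1) ^ d * (d.choose p : RA n) * (tauA n B * alpha B ^ p * beta B ^ (d - p)) := by
  have h : tauA n B ^ (d + 1) = (-1) ^ d * (tauA n B * (alpha B + beta B) ^ d) := by
    induction d with
    | zero => simp
    | succ d ih =>
      rw [pow_succ, ih, pow_succ, pow_succ]
      linear_combination (-1) ^ d * (alpha B + beta B) ^ d * tauA_mul_self hB hB'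
  rw [h, add_pow, Finset.mul_sum, Finset.mul_sum]
  exact Finset.sum_congr rfl fun p _ => by ring

variable {T : ℕ → Finset (Fin (n + 1))} {i : ℕ → ℕ} {s : ℕ}

lemma tauA_mul_beta_pow_mul_prod_eq_zero (hT0 : T 0 = Finset.univ)
    (hT : ∀ r ≤ s, T (r + 1) ⊂ T r) (hi0 : i 0 = 0) (hi : ∀ r < s, i r < i (r + 1)) {r : ℕ}
    (hr : r ≤ s) {q : ℕ} (hq : n < (T (r + 1)).card + q + i r) :
    tauA n (T (r + 1)) * beta (T (r + 1)) ^ q *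
      ∏ j ∈ Finset.range r, tauA n (T (j + 1)) ^ (i (j + 1) - i j) = 0 := by
  induction r generalizing q with
  | zero =>
    have := tauA_mul_beta_pow_eq_zero (q := q) (hT 0 hr)
      (by rw [hT0, Finset.card_univ, Fintype.card_fin]; omega)
    rw [hT0, tauA_univ, mul_one] at this
    rw [this, zero_mul]
  | succ r ih =>
    have hAB := hT (r + 1) hr
    have hB : (T (r + 1)).Nonempty := (Finset.exists_of_ssubset hAB).imp fun _ h => h.1
    have hBu : T (r + 1) ≠ Finset.univ := fun h => by
      have := hT r (by omega)
      rw [h] at this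
      exact this.2 (Finset.subset_univ _)
    have hir := hi r (by omega)
    obtain ⟨d, hd⟩ : ∃ d, i (r + 1) - i r = d + 1 := ⟨i (r + 1) - i r - 1, by omega⟩
    rw [Finset.prod_range_succ, hd, tauA_pow_succ hB hBu,
      Finset.mul_sum, Finset.mul_sum]
    refine Finset.sum_eq_zero fun p hp => ?_
    have hp := Finset.mem_range.1 hp
    by_cases h : (T (r + 1)).card ≤ (T (r + 1 + 1)).card + p + q
    · linear_combination (-1) ^ d * (d.choose p : RA n) * beta (T (r + 1)) ^ (d - p) *
        (∏ j ∈ Finset.range r, tauA n (T (j + 1)) ^ (i (j + 1) - i j)) *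
        tauA_mul_beta_pow_mul_alpha_pow_eq_zero hAB h
    · linear_combination (-1) ^ d * (d.choose p : RA n) * alpha (T (r + 1)) ^ p *
        tauA n (T (r + 1 + 1)) * beta (T (r + 1 + 1)) ^ q *
        ih (q := d - p) (by omega) (by omega)

/-- The evaluation of a monomial in degree `n` supported on the chain `T s ⊂ ⋯ ⊂ T 1`, with the
powers of `tauA n (T (s + 1))` already replaced by a flag and a power of `beta`. -/
lemma flagProd_mul_beta_pow_mul_prod (hT0 : T 0 = Finset.univ)
    (hT : ∀ r ≤ s, T (r + 1) ⊂ T r) (hi0 : i 0 = 0) (hi : ∀ r < s, i r < i (r + 1)) {r : ℕ}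
    (hr : r ≤ s) {q : ℕ} (hq : (T (r + 1)).card + q + i r = n) :
    flagProd (T (r + 1)) * beta (T (r + 1)) ^ q *
      ∏ j ∈ Finset.range r, tauA n (T (j + 1)) ^ (i (j + 1) - i j) =
    (((-1) ^ (i r + r) * ∏ j ∈ Finset.range r,
      (Cb ((i (j + 1) : ℤ) - i j - 1) (((T (j + 1)).card : ℤ) + i (j + 1) - n - 1) *
        Cb (((T (j + 1)).card : ℤ) - (T (j + 2)).card - 1)
          (((T (j + 1)).card : ℤ) + i (j + 1) - n - 1)) : ℤ) : RA n) *
      flagProd Finset.univ := by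
  induction r generalizing q with
  | zero =>
    have := flagProd_mul_beta_pow (q := q) (hT 0 hr)
      (by rw [hT0, Finset.card_univ, Fintype.card_fin]; omega)
    rw [hT0, tauA_univ, mul_one] at this
    simp [this, hi0]
  | succ r ih =>
    have hAB := hT (r + 1) hr
    have hlt := Finset.card_lt_card hAB
    have hB : (T (r + 1)).Nonempty := (Finset.exists_of_ssubset hAB).imp fun _ h => h.1
    have hBu : T (r + 1) ≠ Finset.univ := fun h => by
      have := hT r (by omega)
      rw [h] at this
      exact this.2 (Finset.subset_univ _)
    have hir := hi r (by omega)
    obtain ⟨d, hd⟩ : ∃ d, i (r + 1) - i r = d + 1 := ⟨i (r + 1) - i r - 1, by omega⟩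
    set P := ∏ j ∈ Finset.range r, tauA n (T (j + 1)) ^ (i (j + 1) - i j)
    set c : ℤ := ((T (r + 1)).card : ℤ) + i (r + 1) - n - 1 with hc
    have hzero (p : ℕ) (hp : p < d + 1) (hpc : (p : ℤ) ≠ c) :
        flagProd (T (r + 1 + 1)) * beta (T (r + 1 + 1)) ^ q *
          (P * ((-1) ^ d * (d.choose p : RA n) *
            (tauA n (T (r + 1)) * alpha (T (r + 1)) ^ p * beta (T (r + 1)) ^ (d - p)))) = 0 := by
      by_cases h : (T (r + 1)).card ≤ (T (r + 1 + 1)).card + p + q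
      · have h0 := tauA_mul_beta_pow_mul_alpha_pow_eq_zero hAB h
        rw [mul_assoc] at h0
        linear_combination (-1) ^ d * (d.choose p : RA n) * beta (T (r + 1)) ^ (d - p) * P *
          flagProd_mul_eq_zero h0
      · linear_combination (-1) ^ d * (d.choose p : RA n) * alpha (T (r + 1)) ^ p *
          flagProd (T (r + 1 + 1)) * beta (T (r + 1 + 1)) ^ q *
          tauA_mul_beta_pow_mul_prod_eq_zero hT0 hT hi0 hi (r := r) (q := d - p) (by omega)
            (by omega)
    rw [Finset.prod_range_succ, Finset.prod_range_succ, hd,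
      tauA_pow_succ hB hBu, Finset.mul_sum, Finset.mul_sum, ← hc]
    have hd' : (i (r + 1) : ℤ) - i r - 1 = d := by omega
    rw [hd']
    by_cases hcd : 0 ≤ c ∧ c ≤ d
    · obtain ⟨p, hp⟩ := Int.eq_ofNat_of_zero_le hcd.1
      rw [Finset.sum_eq_single p
        (fun p' hp' hne => hzero p' (Finset.mem_range.1 hp') (by omega))
        (fun h => (h (Finset.mem_range.2 (by omega))).elim)]
      have hb : ((T (r + 1)).card : ℤ) - (T (r + 2)).card - 1 = (p + q : ℕ) := by
        rw [show r + 2 = r + 1 + 1 from rfl]; omega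
      have e1 := flagProd_mul_beta_pow_mul_alpha_pow (p := p) (q := q) hAB (by omega)
      have e2 := ih (q := d - p) (by omega) (by omega)
      have hsgn : i (r + 1) + (r + 1) = (i r + r) + d + 2 := by omega
      have hch : (p + q).choose p = (p + q).choose q := Nat.choose_symm_add
      rw [hb, hp, Cb, Cb, if_pos (by omega), if_pos (by omega)]
      simp only [Int.toNat_natCast, hch, hsgn]
      push_cast at e2 ⊢
      rw [pow_add _ (i r + r + d), pow_add]
      linear_combination (-1) ^ d * (d.choose p : RA n) * beta (T (r + 1)) ^ (d - p) * P * e1 +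
        (-1) ^ d * (d.choose p : RA n) * ((p + q).choose q : RA n) * e2
    · rw [Finset.sum_eq_zero fun p hp => hzero p (Finset.mem_range.1 hp) (by
        have := Finset.mem_range.1 hp; omega)]
      rw [Cb, if_neg hcd]
      simp

lemma flagProd_initSeg {m : ℕ} (hm : m ≤ n + 1) :
    flagProd (Finset.univ.filter fun x : Fin (n + 1) => (x : ℕ) < m) =
      ∏ j ∈ Finset.Icc 1 m, tauA n (Finset.univ.filter fun x : Fin (n + 1) => (x : ℕ) < j) := by
  induction m with
  | zero => simp [flagProd_empty]
  | succ m ih =>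
    have h : (Finset.univ.filter fun x : Fin (n + 1) => (x : ℕ) < m + 1) =
        insert ⟨m, by omega⟩ (Finset.univ.filter fun x : Fin (n + 1) => (x : ℕ) < m) := by
      ext x
      simp [Fin.ext_iff]
      omega
    rw [Finset.prod_Icc_succ_top (by omega), ← ih (by omega), h, flagProd_insert (by simp)]

lemma flagProd_univ : flagProd Finset.univ =
    ∏ j ∈ Finset.Icc 1 n, tauA n (Finset.univ.filter fun x : Fin (n + 1) => (x : ℕ) < j) := by
  have h := flagProd_initSeg (n := n) le_rfl
  rw [Finset.prod_Icc_succ_top (by omega), Finset.filter_true_of_mem (fun x _ => x.2), tauA_univ,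
    mul_one] at h
  exact h

/-- A monomial of degree `n` supported on a chain is an explicit multiple of the point class. -/
lemma prod_tauA_pow_chain (hT0 : T 0 = Finset.univ) (hT : ∀ r ≤ s, T (r + 1) ⊂ T r)
    (hTs : T (s + 1) = ∅) (hi0 : i 0 = 0) (hi : ∀ r < s, i r < i (r + 1)) (his : i s = n) :
    ∏ j ∈ Finset.range s, tauA n (T (j + 1)) ^ (i (j + 1) - i j) =
    (((-1) ^ (n + s) * ∏ j ∈ Finset.range s,
      (Cb ((i (j + 1) : ℤ) - i j - 1) (((T (j + 1)).card : ℤ) + i (j + 1) - n - 1) *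
        Cb (((T (j + 1)).card : ℤ) - (T (j + 2)).card - 1)
          (((T (j + 1)).card : ℤ) + i (j + 1) - n - 1)) : ℤ) : RA n) *
      ∏ j ∈ Finset.Icc 1 n, tauA n (Finset.univ.filter fun x : Fin (n + 1) => (x : ℕ) < j) := by
  have h := flagProd_mul_beta_pow_mul_prod hT0 hT hi0 hi le_rfl (q := 0) (by rw [hTs]; simp [his])
  rw [hTs, flagProd_empty, pow_zero, one_mul, one_mul, his, flagProd_univ] at h
  exact h

end Ring

section Corners

variable {n : ℕ} {lam : ℕ → ℕ}

lemma mem_cornerL {j : ℕ} :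
    j ∈ cornerL n lam ↔ (1 ≤ j ∧ j ≤ n) ∧ lamE n lam (j + 1) < lamE n lam j := by
  simp [cornerL]

lemma iC_zero : iC n lam 0 = 0 := if_pos rfl

lemma iC_succ {r : ℕ} (hr : r < sC n lam) : iC n lam (r + 1) = (cornerL n lam)[r]'hr := by
  rw [iC, if_neg (by omega), Nat.add_sub_cancel, List.getD_eq_getElem _ _ hr]

lemma iC_sC_succ : iC n lam (sC n lam + 1) = n + 1 := by
  simp [iC, sC]

lemma iC_succ_mem {r : ℕ} (hr : r < sC n lam) : iC n lam (r + 1) ∈ cornerL n lam := by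
  rw [iC_succ hr]
  exact List.getElem_mem _

lemma iC_lt_iC_succ {r : ℕ} (hr : r < sC n lam) : iC n lam r < iC n lam (r + 1) := by
  cases r with
  | zero =>
    have := (mem_cornerL.1 (iC_succ_mem hr)).1.1
    rw [iC_zero]
    omega
  | succ r =>
    rw [iC_succ hr, iC_succ (by omega)]
    exact (Finset.sortedLT_sort _).strictMono_get (a := ⟨r, Nat.lt_of_succ_lt hr⟩) (b := ⟨r + 1, hr⟩)
      (by simp [Fin.lt_def])

lemma exists_iC_eq {j : ℕ} (hj : j ∈ cornerL n lam) : ∃ r < sC n lam, iC n lam (r + 1) = j := by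
  obtain ⟨r, hr, rfl⟩ := List.getElem_of_mem hj
  exact ⟨r, hr, iC_succ hr⟩

lemma iC_mono {a b : ℕ} (hab : a ≤ b) (hb : b ≤ sC n lam) : iC n lam a ≤ iC n lam b := by
  induction b, hab using Nat.le_induction with
  | base => rfl
  | succ b _ ih => exact (ih (by omega)).trans (iC_lt_iC_succ (by omega)).le

lemma notMem_cornerL_of_between {r j : ℕ} (hr : r < sC n lam) (h₁ : iC n lam r < j)
    (h₂ : j < iC n lam (r + 1)) : j ∉ cornerL n lam := by
  intro hj
  obtain ⟨t, ht, rfl⟩ := exists_iC_eq hj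
  rcases Nat.lt_or_ge t r with h | h
  · have := iC_mono (n := n) (lam := lam) (show t + 1 ≤ r from h) (by omega)
    omega
  · have := iC_mono (n := n) (lam := lam) (show r + 1 ≤ t + 1 by omega) (by omega)
    omega

end Corners

/-- The elements of the chain `S` at the corners of its diagram, from large to small. -/
def cornerSet (n : ℕ) (S : ℕ → Finset (Fin (n + 1))) (r : ℕ) : Finset (Fin (n + 1)) :=
  if r = 0 then Finset.univ
  else if r ≤ sC n (fun i => (S (n + 1 - i)).card)
  then S (n + 1 - iC n (fun i => (S (n + 1 - i)).card) r) else ∅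

section Chain

variable {n : ℕ} {S : ℕ → Finset (Fin (n + 1))}

local notation "lamS" => fun i => Finset.card (S (n + 1 - i))

lemma prod_chain_eq_prod_corners
    (hS : ∀ i j, 1 ≤ i → i ≤ j → j ≤ n → S i ⊆ S j) {r : ℕ} (hr : r ≤ sC n lamS) :
    ∏ j ∈ Finset.Ioc 0 (iC n lamS r), tauA n (S (n + 1 - j)) =
      ∏ j ∈ Finset.range r,
        tauA n (cornerSet n S (j + 1)) ^ (iC n lamS (j + 1) - iC n lamS j) := by
  induction r with
  | zero => simp [iC_zero]
  | succ r ih =>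
    have hlt := iC_lt_iC_succ (n := n) (lam := lamS) hr
    obtain ⟨⟨h1, h2⟩, -⟩ := mem_cornerL.1 (iC_succ_mem (n := n) (lam := lamS) hr)
    have hconst : ∀ j, iC n lamS r < j → j ≤ iC n lamS (r + 1) →
        S (n + 1 - j) = S (n + 1 - iC n lamS (r + 1)) := by
      intro j hj hj'
      refine Nat.decreasingInduction' (P := fun j => S (n + 1 - j) = _) ?_ hj' rfl
      intro m hm hjm hP
      rw [← hP]
      have hnot := notMem_cornerL_of_between hr (j := m) (by omega) hm
      rw [mem_cornerL, lamE, lamE, if_pos (by omega), if_pos (by omega)] at hnot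
      exact (Finset.eq_of_subset_of_card_le (hS _ _ (by omega) (by omega) (by omega))
        (by by_contra h; exact hnot ⟨by omega, by omega⟩)).symm
    rw [Finset.prod_range_succ, ← ih (by omega),
      ← Finset.prod_Ioc_consecutive _ (Nat.zero_le _) hlt.le]
    congr 1
    rw [Finset.prod_congr rfl (g := fun _ => tauA n (cornerSet n S (r + 1))) fun j hj => ?_,
      Finset.prod_const, Nat.card_Ioc]
    rw [Finset.mem_Ioc] at hj
    rw [hconst j hj.1 hj.2, cornerSet, if_neg (by omega), if_pos hr]

lemma card_cornerSet {r : ℕ} (h1 : 1 ≤ r) (hr : r ≤ sC n lamS + 1) :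
    (cornerSet n S r).card = lamE n lamS (iC n lamS r) := by
  rw [cornerSet, if_neg (by omega)]
  split_ifs with h
  · obtain ⟨r, rfl⟩ := Nat.exists_eq_add_of_le' h1
    rw [lamE, if_pos (mem_cornerL.1 (iC_succ_mem (n := n) (lam := lamS) h)).1.2]
  · rw [show r = sC n lamS + 1 by omega, iC_sC_succ, lamE, if_neg (by omega), Finset.card_empty]

lemma prod_tauA_chain (hS : ∀ i j, 1 ≤ i → i ≤ j → j ≤ n → S i ⊆ S j)
    (hne : ∀ i, 1 ≤ i → i ≤ n → (S i).Nonempty ∧ S i ≠ Finset.univ) :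
    ∏ i ∈ Finset.Icc 1 n, tauA n (S i) = (IY n lamS : RA n) *
      ∏ i ∈ Finset.Icc 1 n, tauA n (Finset.univ.filter (fun x : Fin (n + 1) => (x : ℕ) < i)) := by
  have hmem {r : ℕ} (hr : r < sC n lamS) :=
    mem_cornerL.1 (iC_succ_mem (n := n) (lam := lamS) hr)
  have hlast : iC n lamS (sC n lamS) = n := by
    rcases Nat.eq_zero_or_pos n with hn | hn
    · have : sC n lamS = 0 := by simp [sC, cornerL, hn]
      rw [this, iC_zero, hn]
    · obtain ⟨r, hr, hrn⟩ := exists_iC_eq (n := n) (lam := lamS) (j := n) (mem_cornerL.2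
        ⟨⟨hn, le_rfl⟩, by
          rw [lamE, lamE, if_neg (by omega), if_pos le_rfl]
          exact (hne _ (by omega) (by omega)).1.card_pos⟩)
      have h := iC_mono (n := n) (lam := lamS) (show r + 1 ≤ sC n lamS from hr) le_rfl
      obtain ⟨t, ht⟩ := Nat.exists_eq_add_one_of_ne_zero (Nat.ne_zero_of_lt hr)
      have := (hmem (r := t) (by omega)).1.2
      rw [← ht] at this
      omega
  have hT : ∀ r ≤ sC n lamS, cornerSet n S (r + 1) ⊂ cornerSet n S r := by
    intro r hr
    have hval {t : ℕ} (ht : t < sC n lamS) :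
        cornerSet n S (t + 1) = S (n + 1 - iC n lamS (t + 1)) := by
      rw [cornerSet, if_neg (by omega), if_pos (Nat.succ_le_of_lt ht)]
    rcases hr.lt_or_eq with hr | rfl
    · have hm := hmem hr
      rw [hval hr]
      cases r with
      | zero =>
        rw [cornerSet, if_pos rfl]
        exact Finset.ssubset_univ_iff.2 (hne _ (by omega) (by omega)).2
      | succ r =>
        have hm' := hmem (r := r) (by omega)
        have hlt := iC_lt_iC_succ hr
        rw [hval (by omega)]
        refine (hS _ _ (by omega) (by omega) (by omega)).ssubset_of_ne fun h => ?_
        have h2 := hm'.2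
        rw [lamE, lamE, if_pos (by omega), if_pos (by omega)] at h2
        have := Finset.card_le_card (hS (n + 1 - iC n lamS (r + 1 + 1))
          (n + 1 - (iC n lamS (r + 1) + 1)) (by omega) (by omega) (by omega))
        rw [h] at this
        omega
    · have hlast : cornerSet n S (sC n lamS + 1) = ∅ := by
        rw [cornerSet, if_neg (by omega), if_neg (by omega)]
      rw [hlast, Finset.empty_ssubset]
      rcases Nat.eq_zero_or_eq_succ_pred (sC n lamS) with h | h
      · rw [h, cornerSet, if_pos rfl]
        exact Finset.univ_nonempty
      · rw [h]
        have hlt : (sC n lamS).pred < sC n lamS := by omega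
        have hm := hmem hlt
        rw [hval hlt]
        exact (hne _ (by omega) (by omega)).1
  have key := prod_tauA_pow_chain (T := cornerSet n S) (i := iC n lamS) (s := sC n lamS)
    (by rw [cornerSet, if_pos rfl]) hT
    (by rw [cornerSet, if_neg (by omega), if_neg (by omega)]) iC_zero
    (fun r hr => iC_lt_iC_succ hr) hlast
  rw [← prod_chain_eq_prod_corners hS le_rfl, hlast] at key
  have hrefl : ∏ i ∈ Finset.Icc 1 n, tauA n (S i) =
      ∏ j ∈ Finset.Ioc 0 n, tauA n (S (n + 1 - j)) := by
    refine Finset.prod_nbij' (fun j => n + 1 - j) (fun j => n + 1 - j) ?_ ?_ ?_ ?_ ?_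
    · intro j hj; rw [Finset.mem_Icc] at hj; rw [Finset.mem_Ioc]; omega
    · intro j hj; rw [Finset.mem_Ioc] at hj; rw [Finset.mem_Icc]; omega
    · intro j hj; rw [Finset.mem_Icc] at hj; omega
    · intro j hj; rw [Finset.mem_Ioc] at hj; omega
    · intro j hj
      rw [Finset.mem_Icc] at hj
      rw [Nat.sub_sub_self (by omega)]
  rw [hrefl, key, IY]
  congr 3
  refine Finset.prod_nbij' (fun j => j + 1) (fun r => r - 1) ?_ ?_ ?_ ?_ ?_
  · intro j hj; rw [Finset.mem_range] at hj; rw [Finset.mem_Icc]; omega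
  · intro j hj; rw [Finset.mem_Icc] at hj; rw [Finset.mem_range]; omega
  · intro j hj; omega
  · intro j hj; rw [Finset.mem_Icc] at hj; omega
  · intro j hj
    rw [Finset.mem_range] at hj
    rw [card_cornerSet (by omega) (by omega), card_cornerSet (by omega) (by omega)]
    rfl

end Chain

lemma card_pSet {n : ℕ} (u : Equiv.Perm (Fin (n + 1))) {i : ℕ} (hi : i ≤ n + 1) :
    (pSet n u i).card = i := by
  rw [pSet, Finset.card_image_of_injective _ u.injective, Fin.card_filter_val_lt]
  omega

lemma pSet_nonempty_and_ne_univ {n : ℕ} (u : Equiv.Perm (Fin (n + 1))) {i : ℕ}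
    (hi : i ∈ Finset.Icc 1 n) : (pSet n u i).Nonempty ∧ pSet n u i ≠ Finset.univ := by
  rw [Finset.mem_Icc] at hi
  have h := card_pSet u (i := i) (by omega)
  refine ⟨Finset.card_pos.1 (by omega), fun h' => ?_⟩
  rw [h', Finset.card_univ, Fintype.card_fin] at h
  omega

/-- A finite family of pairwise comparable finite sets can be ordered into a chain. -/
lemma exists_chain_of_pairwise_comparable {α : Type*} [DecidableEq α] (M : Multiset (Finset α))
    (h : ∀ A ∈ M, ∀ B ∈ M, A ⊆ B ∨ B ⊆ A) :
    ∃ S : ℕ → Finset α, M = (Finset.Icc 1 M.card).val.map S ∧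
      ∀ i j, 1 ≤ i → i ≤ j → j ≤ M.card → S i ⊆ S j := by
  let r : Finset α → Finset α → Prop := fun A B => A.card ≤ B.card
  have : Std.Total r := ⟨fun A B => Nat.le_total _ _⟩
  have : IsTrans (Finset α) r := ⟨fun A B C => Nat.le_trans⟩
  obtain ⟨L, hLM, hL⟩ : ∃ L : List (Finset α), (L : Multiset (Finset α)) = M ∧ L.Pairwise r :=
    ⟨M.toList.insertionSort r, by
      rw [← Multiset.coe_eq_coe.2 (List.perm_insertionSort r M.toList).symm, Multiset.coe_toList],
      List.pairwise_insertionSort r _⟩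
  subst hLM
  rw [Multiset.coe_card]
  refine ⟨fun i => L.getD (i - 1) ∅, ?_, ?_⟩
  · have hI : Finset.Icc 1 L.length = (Finset.range L.length).map (addRightEmbedding 1) := by
      ext x
      simp only [Finset.mem_Icc, Finset.mem_map, Finset.mem_range, addRightEmbedding_apply]
      exact ⟨fun h => ⟨x - 1, by omega, by omega⟩, by rintro ⟨y, hy, rfl⟩; omega⟩
    rw [hI, Finset.map_val, Multiset.map_map, Finset.range_val, Multiset.range,
      Multiset.map_coe]
    congr 1
    refine List.ext_getElem (by simp) fun m h₁ h₂ => ?_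
    simp [h₁]
  · intro i j hi hij hj
    have hi' : i - 1 < L.length := by omega
    have hj' : j - 1 < L.length := by omega
    simp only [List.getD_eq_getElem _ _ hi', List.getD_eq_getElem _ _ hj']
    rcases hij.eq_or_lt with rfl | hlt
    · rfl
    · have hc : (L[i - 1]).card ≤ (L[j - 1]).card :=
        List.pairwise_iff_getElem.1 hL _ _ hi' hj' (by omega)
      rcases h _ (Multiset.mem_coe.2 (List.getElem_mem hi')) _
        (Multiset.mem_coe.2 (List.getElem_mem hj')) with h | h
      · exact h
      · exact (Finset.eq_of_subset_of_card_le h hc).ge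

lemma prod_tauA_eq_zero_of_not_comparable {n : ℕ} {M : Multiset (Finset (Fin (n + 1)))}
    {A B : Finset (Fin (n + 1))} (hA : A ∈ M) (hB : B ∈ M) (h₁ : ¬ A ⊆ B) (h₂ : ¬ B ⊆ A) :
    (M.map (tauA n)).prod = 0 := by
  obtain ⟨M', rfl⟩ := Multiset.exists_cons_of_mem hA
  have hBA : B ≠ A := by
    rintro rfl
    exact h₁ subset_rfl
  obtain ⟨M'', rfl⟩ := Multiset.exists_cons_of_mem ((Multiset.mem_cons.1 hB).resolve_left hBA)
  rw [Multiset.map_cons, Multiset.map_cons, Multiset.prod_cons, Multiset.prod_cons, ← mul_assoc,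
    tauA_mul_of_not_subset h₁ h₂, zero_mul]

end PermutohedralRing

/-- Let `u, v, w` be permutations of `[n+1]` with `d(u) + d(v) = d(w)`, and
consider the family (with multiplicity) of the sets `u[i]` for descents `i` of `u`, `v[i]` for
descents `i` of `v`, and `w[i]` for ascents `i` of `w`.  If the family can be ordered into a chain
`S_1 ⊆ … ⊆ S_n`, then `[X_u][X_v][Y^w] = I(λ_{u,v}^w) · τ_{{1}} ⋯ τ_{{1,…,n}}` in `R_n`, where
`λ_{u,v}^w` consists of the cardinalities `|S_i|` in weakly decreasing order; otherwise
`[X_u][X_v][Y^w] = 0`. -/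
theorem typeA_triple_intersection (n : ℕ) (hn : 1 ≤ n)
    (u v w : Equiv.Perm (Fin (n + 1)))
    (hd : (descents n u).card + (descents n v).card = (descents n w).card) :
    (∀ S : ℕ → Finset (Fin (n + 1)),
        ((descents n u).val.map (pSet n u) + (descents n v).val.map (pSet n v) +
            (ascents n w).val.map (pSet n w)) = (Finset.Icc 1 n).val.map S →
        (∀ i j, 1 ≤ i → i ≤ j → j ≤ n → S i ⊆ S j) →
        (∏ i ∈ descents n u, tauA n (pSet n u i)) * (∏ i ∈ descents n v, tauA n (pSet n v i)) *
            (∏ i ∈ ascents n w, tauA n (pSet n w i)) =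
          (IY n (fun i => (S (n + 1 - i)).card) : RA n) *
            ∏ i ∈ Finset.Icc 1 n, tauA n (Finset.univ.filter (fun x : Fin (n + 1) => (x : ℕ) < i)))
    ∧ ((¬ ∃ S : ℕ → Finset (Fin (n + 1)),
          ((descents n u).val.map (pSet n u) + (descents n v).val.map (pSet n v) +
              (ascents n w).val.map (pSet n w)) = (Finset.Icc 1 n).val.map S ∧
          (∀ i j, 1 ≤ i → i ≤ j → j ≤ n → S i ⊆ S j)) →
        (∏ i ∈ descents n u, tauA n (pSet n u i)) * (∏ i ∈ descents n v, tauA n (pSet n v i)) *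
            (∏ i ∈ ascents n w, tauA n (pSet n w i)) = 0) := by
  set M := (descents n u).val.map (pSet n u) + (descents n v).val.map (pSet n v) +
    (ascents n w).val.map (pSet n w) with hM
  have hprod : (∏ i ∈ descents n u, tauA n (pSet n u i)) *
      (∏ i ∈ descents n v, tauA n (pSet n v i)) * (∏ i ∈ ascents n w, tauA n (pSet n w i)) =
      (M.map (tauA n)).prod := by
    simp only [hM, Multiset.map_add, Multiset.prod_add, Multiset.map_map]
    rfl
  rw [hprod]
  constructor
  · intro S hMS hS
    have hne : ∀ A ∈ M, A.Nonempty ∧ A ≠ Finset.univ := by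
      intro A hA
      simp only [hM, Multiset.mem_add, Multiset.mem_map, Finset.mem_val] at hA
      rcases hA with (⟨i, hi, rfl⟩ | ⟨i, hi, rfl⟩) | ⟨i, hi, rfl⟩
      all_goals
        exact PermutohedralRing.pSet_nonempty_and_ne_univ _ (Finset.mem_of_mem_filter i hi)
    rw [← PermutohedralRing.prod_tauA_chain hS fun i h1 h2 => hne _ (by
      rw [hMS]
      exact Multiset.mem_map_of_mem S (Finset.mem_Icc.2 ⟨h1, h2⟩)),
      hMS, Multiset.map_map]
    rfl
  · intro hchain
    have hcard : M.card = n := by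
      have hw : (descents n w).card + (ascents n w).card = n := by
        rw [descents, ascents, Finset.card_filter_add_card_filter_not, Nat.card_Icc]
        omega
      simp only [hM, Multiset.card_add, Multiset.card_map, Finset.card_val]
      omega
    by_cases h : ∀ A ∈ M, ∀ B ∈ M, A ⊆ B ∨ B ⊆ A
    · have := PermutohedralRing.exists_chain_of_pairwise_comparable M h
      rw [hcard] at this
      exact (hchain this).elim
    · push Not at h
      obtain ⟨A, hA, B, hB, h₁, h₂⟩ := h
      exact PermutohedralRing.prod_tauA_eq_zero_of_not_comparable hA hB h₁ h₂
end

section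
/- Let λ = (λ_1 ≥ … ≥ λ_n) be a Young diagram with λ_n > 0 and λ_1 ≤ n, with corner data i_1 < … < i_s and a_r, b_r, c_r as defined, and suppose 0 ≤ c_t ≤ min(a_t, b_t) for all t ∈ {1,…,s}. Let r satisfy 2 ≤ r ≤ s and i_r − i_{r−1} ≥ 2. Define Young diagrams λ' and λ'' by λ'_j = n+1−j if j = i_{r−1}+1 and λ'_j = λ_j otherwise, and λ''_j = n+1−j if j = i_r and λ''_j = λ_j otherwise. If λ ≠ λ' and λ ≠ λ'', then I(λ) = − C(b_{r−1}, c_{r−1})·I(λ') − C(b_r, c_r)·I(λ''). -/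
/-- The set of lower-right corners of `lam`. -/
def cornerSet (n : ℕ) (lam : ℕ → ℕ) : Finset ℕ :=
  (Finset.Icc 1 n).filter (fun i => lamE n lam (i + 1) < lamE n lam i)

lemma mem_cornerSet {n : ℕ} {lam : ℕ → ℕ} {i : ℕ} :
    i ∈ cornerSet n lam ↔ (1 ≤ i ∧ i ≤ n) ∧ lamE n lam (i + 1) < lamE n lam i := by
  simp [cornerSet]

lemma mem_cornerL {n : ℕ} {lam : ℕ → ℕ} {i : ℕ} :
    i ∈ cornerL n lam ↔ i ∈ cornerSet n lam := by
  simp [cornerL, cornerSet]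

lemma pairwise_cornerL (n : ℕ) (lam : ℕ → ℕ) : (cornerL n lam).Pairwise (· < ·) :=
  Finset.sortedLT_sort _ |>.pairwise

lemma iC_eq_getElem {n : ℕ} {lam : ℕ → ℕ} {t : ℕ} (h1 : 1 ≤ t) (hs : t ≤ sC n lam) :
    iC n lam t = (cornerL n lam)[t - 1]'(by unfold sC at hs; omega) := by
  unfold sC at hs
  rw [iC, if_neg (by omega), List.getD_eq_getElem]

lemma iC_of_sC_lt {n : ℕ} {lam : ℕ → ℕ} {t : ℕ} (hs : sC n lam < t) :
    iC n lam t = n + 1 := by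
  unfold sC at hs
  rw [iC, if_neg (by omega), List.getD_eq_default]
  omega

lemma iC_mem_cornerSet {n : ℕ} {lam : ℕ → ℕ} {t : ℕ} (h1 : 1 ≤ t) (hs : t ≤ sC n lam) :
    iC n lam t ∈ cornerSet n lam := by
  rw [iC_eq_getElem h1 hs, ← mem_cornerL]
  exact List.getElem_mem _

lemma iC_lt_iC {n : ℕ} {lam : ℕ → ℕ} {t u : ℕ} (htu : t < u) (hu : u ≤ sC n lam + 1) :
    iC n lam t < iC n lam u := by
  rcases Nat.eq_zero_or_pos t with rfl | ht
  · rw [iC, if_pos rfl]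
    by_cases h : u ≤ sC n lam
    · have := mem_cornerSet.1 (iC_mem_cornerSet htu h)
      omega
    · rw [iC_of_sC_lt (by omega)]
      omega
  · by_cases h : u ≤ sC n lam
    · rw [iC_eq_getElem ht (by omega), iC_eq_getElem (by omega) h]
      exact List.pairwise_iff_getElem.1 (pairwise_cornerL n lam) _ _ _ _ (by omega)
    · rw [iC_of_sC_lt (t := u) (by omega)]
      have := mem_cornerSet.1 (iC_mem_cornerSet (n := n) (lam := lam) ht (by omega))
      omega

lemma exists_iC_eq {n : ℕ} {lam : ℕ → ℕ} {i : ℕ} (hi : i ∈ cornerSet n lam) :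
    ∃ t, 1 ≤ t ∧ t ≤ sC n lam ∧ iC n lam t = i := by
  obtain ⟨k, hk, rfl⟩ := List.mem_iff_getElem.1 (mem_cornerL.2 hi)
  refine ⟨k + 1, by omega, by unfold sC; omega, ?_⟩
  rw [iC_eq_getElem (by omega) (by unfold sC; omega)]
  simp

lemma notMem_cornerSet_of_between {n : ℕ} {lam : ℕ → ℕ} {r j : ℕ} (hr : 1 ≤ r)
    (hrs : r ≤ sC n lam) (h1 : iC n lam (r - 1) < j) (h2 : j < iC n lam r) :
    j ∉ cornerSet n lam := by
  intro hj
  obtain ⟨t, ht1, hts, rfl⟩ := exists_iC_eq hj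
  rcases lt_trichotomy t r with h | rfl | h
  · rcases (Nat.le_sub_one_of_lt h).eq_or_lt with rfl | h'
    · exact lt_irrefl _ h1
    · have := iC_lt_iC (n := n) (lam := lam) h' (by omega)
      omega
  · exact lt_irrefl _ h2
  · have := iC_lt_iC (n := n) (lam := lam) h (by omega)
    omega

lemma lamE_eq_of_between {n : ℕ} {lam : ℕ → ℕ} {r j : ℕ}
    (hanti : ∀ i j, 1 ≤ i → i ≤ j → j ≤ n → lam j ≤ lam i) (hr : 1 ≤ r)
    (hrs : r ≤ sC n lam) (h1 : iC n lam (r - 1) < j) (h2 : j ≤ iC n lam r) :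
    lamE n lam j = lamE n lam (iC n lam r) := by
  have hn : iC n lam r ≤ n := (mem_cornerSet.1 (iC_mem_cornerSet hr hrs)).1.2
  induction h2 using Nat.decreasingInduction with
  | self => rfl
  | of_succ k hk ih =>
    rw [← ih (by omega)]
    have hk' := mem_cornerSet.not.1 (notMem_cornerSet_of_between hr hrs h1 hk)
    have := hanti k (k + 1) (by omega) (by omega) (by omega)
    simp only [lamE, if_pos (show k ≤ n by omega), if_pos (show k + 1 ≤ n by omega)] at hk' ⊢
    omega

lemma cornerL_insert {n : ℕ} {lam mu : ℕ → ℕ} {r x : ℕ} (hr : 1 ≤ r) (hrs : r ≤ sC n lam)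
    (h1 : iC n lam (r - 1) < x) (h2 : x < iC n lam r)
    (hmu : cornerSet n mu = insert x (cornerSet n lam)) :
    cornerL n mu = (cornerL n lam).take (r - 1) ++ x :: (cornerL n lam).drop (r - 1) := by
  have hlam := pairwise_cornerL n lam
  have hlt : ∀ y ∈ (cornerL n lam).take (r - 1), y < x := by
    intro y hy
    obtain ⟨k, hk, rfl⟩ := List.mem_iff_getElem.1 hy
    simp only [List.length_take, lt_min_iff] at hk
    rw [List.getElem_take]
    have hk1 : iC n lam (k + 1) = (cornerL n lam)[k] :=
      iC_eq_getElem (by omega) (by unfold sC; omega)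
    rcases (show k + 1 ≤ r - 1 by omega).eq_or_lt with h | h
    · rw [← hk1, h]; exact h1
    · have := iC_lt_iC (n := n) (lam := lam) h (by omega)
      omega
  have hgt : ∀ y ∈ (cornerL n lam).drop (r - 1), x < y := by
    intro y hy
    obtain ⟨k, hk, rfl⟩ := List.mem_iff_getElem.1 hy
    simp only [List.length_drop] at hk
    rw [List.getElem_drop]
    have hk1 : iC n lam (r - 1 + k + 1) = (cornerL n lam)[r - 1 + k] :=
      iC_eq_getElem (by omega) (by unfold sC; omega)
    rcases (show r ≤ r - 1 + k + 1 by omega).eq_or_lt with h | h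
    · rw [← hk1, ← h]; exact h2
    · have := iC_lt_iC (n := n) (lam := lam) h (by unfold sC; omega)
      omega
  have hpw : ((cornerL n lam).take (r - 1) ++ x :: (cornerL n lam).drop (r - 1)).Pairwise
      (· < ·) := by
    rw [List.pairwise_append, List.pairwise_cons]
    refine ⟨hlam.take, ⟨hgt, hlam.drop⟩, fun a ha b hb => ?_⟩
    rcases List.mem_cons.1 hb with rfl | hb
    · exact hlt a ha
    · exact (hlt a ha).trans (hgt b hb)
  refine List.Perm.eq_of_pairwise (le := (· < ·)) (fun a b _ _ hab hba => (hab.asymm hba).elim)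
    (pairwise_cornerL n mu) hpw ?_
  rw [List.perm_ext_iff_of_nodup ((pairwise_cornerL n mu).imp ne_of_lt) (hpw.imp ne_of_lt)]
  intro a
  rw [mem_cornerL, hmu, Finset.mem_insert, ← mem_cornerL]
  conv_lhs => rw [← List.take_append_drop (r - 1) (cornerL n lam)]
  simp only [List.mem_append, List.mem_cons]
  tauto

lemma sC_insert {n : ℕ} {lam mu : ℕ → ℕ} {r x : ℕ} (hr : 1 ≤ r)
    (hrs : r ≤ sC n lam) (h1 : iC n lam (r - 1) < x) (h2 : x < iC n lam r)
    (hmu : cornerSet n mu = insert x (cornerSet n lam)) :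
    sC n mu = sC n lam + 1 := by
  unfold sC at *
  rw [cornerL_insert hr hrs h1 h2 hmu]
  simp
  omega

lemma iC_insert_of_lt {n : ℕ} {lam mu : ℕ → ℕ} {r x : ℕ} (hr : 1 ≤ r)
    (hrs : r ≤ sC n lam) (h1 : iC n lam (r - 1) < x) (h2 : x < iC n lam r)
    (hmu : cornerSet n mu = insert x (cornerSet n lam))
    {t : ℕ} (ht : t < r) : iC n mu t = iC n lam t := by
  unfold iC sC at *
  rw [cornerL_insert hr hrs h1 h2 hmu]
  split_ifs
  · rfl
  · rw [List.getD_append _ _ _ _ (by simp; omega)]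
    simp [List.getD_eq_getElem?_getD, show t - 1 < r - 1 by omega]

lemma iC_insert_self {n : ℕ} {lam mu : ℕ → ℕ} {r x : ℕ} (hr : 1 ≤ r)
    (hrs : r ≤ sC n lam) (h1 : iC n lam (r - 1) < x) (h2 : x < iC n lam r)
    (hmu : cornerSet n mu = insert x (cornerSet n lam)) :
    iC n mu r = x := by
  unfold iC sC at *
  rw [cornerL_insert hr hrs h1 h2 hmu, if_neg (by omega),
    List.getD_append_right _ _ _ _ (by simp)]
  simp [show min (r - 1) (cornerL n lam).length = r - 1 by omega]

lemma iC_insert_succ {n : ℕ} {lam mu : ℕ → ℕ} {r x : ℕ} (hr : 1 ≤ r)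
    (hrs : r ≤ sC n lam) (h1 : iC n lam (r - 1) < x) (h2 : x < iC n lam r)
    (hmu : cornerSet n mu = insert x (cornerSet n lam))
    {t : ℕ} (ht : r ≤ t) : iC n mu (t + 1) = iC n lam t := by
  unfold iC sC at *
  rw [cornerL_insert hr hrs h1 h2 hmu, if_neg (by omega), if_neg (by omega),
    List.getD_append_right _ _ _ _ (by simp; omega)]
  simp only [List.length_take, show min (r - 1) (cornerL n lam).length = r - 1 by omega]
  rw [show t + 1 - 1 - (r - 1) = (t - r) + 1 by omega, List.getD_cons_succ]
  simp [List.getD_eq_getElem?_getD, show r - 1 + (t - r) = t - 1 by omega]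

lemma prod_Icc_split {M : Type*} [CommMonoid M] (f : ℕ → M) {r s : ℕ} (hr : 2 ≤ r) (hrs : r ≤ s) :
    ∏ t ∈ Finset.Icc 1 s, f t =
      (∏ t ∈ Finset.Ico 1 (r - 1), f t) * (f (r - 1) * f r) *
        ∏ t ∈ Finset.Ico (r + 1) (s + 1), f t := by
  obtain ⟨r, rfl⟩ := Nat.exists_eq_add_of_le' (show 1 ≤ r by omega)
  have h : Finset.Icc 1 s = Finset.Ico 1 (s + 1) := rfl
  rw [h, ← Finset.prod_Ico_consecutive f (show 1 ≤ r + 1 + 1 by omega) (by omega),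
    Finset.prod_Ico_succ_top (by omega), Finset.prod_Ico_succ_top (by omega)]
  simp only [Nat.add_sub_cancel, mul_assoc]

/-- The effect on `I` of creating exactly one new corner, between the corners `r - 1` and `r`. -/
lemma IY_insert {n : ℕ} {lam mu : ℕ → ℕ} {r x : ℕ} (hr : 2 ≤ r) (hrs : r ≤ sC n lam)
    (h1 : iC n lam (r - 1) < x) (h2 : x < iC n lam r)
    (hmu : cornerSet n mu = insert x (cornerSet n lam))
    (hval : ∀ t ≤ sC n lam + 1, t ≠ r → lamE n mu (iC n lam t) = lamE n lam (iC n lam t)) :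
    IY n mu = -((-1) ^ (n + sC n lam) * ((∏ t ∈ Finset.Ico 1 (r - 1), yC n lam t) *
      (yC n mu (r - 1) * yC n mu r * yC n mu (r + 1)) *
        ∏ t ∈ Finset.Ico (r + 1) (sC n lam + 1), yC n lam t)) := by
  have hr1 : 1 ≤ r := by omega
  have hlt {t : ℕ} (ht : t < r) := iC_insert_of_lt hr1 hrs h1 h2 hmu ht
  have hsucc {t : ℕ} (ht : r ≤ t) := iC_insert_succ hr1 hrs h1 h2 hmu ht
  have hlow : ∏ t ∈ Finset.Ico 1 (r - 1), yC n mu t = ∏ t ∈ Finset.Ico 1 (r - 1), yC n lam t := by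
    refine Finset.prod_congr rfl fun t ht => ?_
    rw [Finset.mem_Ico] at ht
    simp only [yC, aC, bC, cC, hlt (show t < r by omega), hlt (show t - 1 < r by omega),
      hlt (show t + 1 < r by omega), hval t (by omega) (by omega),
      hval (t + 1) (by omega) (by omega)]
  have hhigh : ∏ t ∈ Finset.Ico (r + 1 + 1) (sC n lam + 1 + 1), yC n mu t =
      ∏ t ∈ Finset.Ico (r + 1) (sC n lam + 1), yC n lam t := by
    rw [← Finset.prod_Ico_add' (yC n mu) (r + 1) (sC n lam + 1) 1]
    refine Finset.prod_congr rfl fun t ht => ?_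
    rw [Finset.mem_Ico] at ht
    have h3 : iC n mu t = iC n lam (t - 1) := by
      have := hsucc (show r ≤ t - 1 by omega)
      rwa [Nat.sub_add_cancel (by omega)] at this
    simp only [yC, aC, bC, cC, Nat.add_sub_cancel, h3, hsucc (show r ≤ t by omega),
      hsucc (show r ≤ t + 1 by omega), hval t (by omega) (by omega),
      hval (t + 1) (by omega) (by omega)]
  rw [IY, sC_insert hr1 hrs h1 h2 hmu, prod_Icc_split (yC n mu) (r := r + 1) (by omega) (by omega),
    hhigh, Nat.add_sub_cancel, ← hlow]
  obtain ⟨r, rfl⟩ := Nat.exists_eq_add_of_le' hr1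
  rw [Finset.prod_Ico_succ_top (by omega), Nat.add_sub_cancel]
  ring

lemma Cb_self {x : ℤ} (hx : 0 ≤ x) : Cb x x = 1 := by
  simp [Cb, hx]

lemma Cb_zero_right {x : ℤ} (hx : 0 ≤ x) : Cb x 0 = 1 := by
  simp [Cb, hx]

lemma Cb_pascal {x y : ℤ} (hy : 1 ≤ y) (hxy : y < x) :
    Cb x y = Cb (x - 1) y + Cb (x - 1) (y - 1) := by
  obtain ⟨k, rfl⟩ : ∃ k : ℕ, y = k + 1 := ⟨(y - 1).toNat, by omega⟩
  obtain ⟨m, rfl⟩ : ∃ m : ℕ, x = m + 1 := ⟨(x - 1).toNat, by omega⟩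
  rw [Cb, Cb, Cb, if_pos (by omega), if_pos (by omega), if_pos (by omega)]
  simp only [add_sub_cancel_right, Int.toNat_natCast]
  rw [show ((m : ℤ) + 1).toNat = m + 1 by omega, show ((k : ℤ) + 1).toNat = k + 1 by omega,
    Nat.choose_succ_succ]
  push_cast
  ring

/-- recursion for `I`. Let `λ` be a Young diagram (`λ_1 ≥ … ≥ λ_n ≥ 1`,
`λ_1 ≤ n`) with `0 ≤ c_t ≤ min(a_t, b_t)` for all `t ∈ {1,…,s}`, and let `2 ≤ r ≤ s` with
`i_r − i_{r−1} ≥ 2`.  Define `λ'` and `λ''` by replacing `λ_j` by `n+1−j` at `j = i_{r−1}+1`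
resp. `j = i_r`.  If `λ ≠ λ'` and `λ ≠ λ''`, then
`I(λ) = − C(b_{r−1}, c_{r−1}) I(λ') − C(b_r, c_r) I(λ'')`. -/
theorem I_recursion (n : ℕ) (hn : 1 ≤ n) (lam : ℕ → ℕ)
    (hanti : ∀ i j, 1 ≤ i → i ≤ j → j ≤ n → lam j ≤ lam i)
    (hpos : 0 < lam n) (hle : lam 1 ≤ n)
    (hcross : ∀ t ∈ Finset.Icc 1 (sC n lam),
        0 ≤ cC n lam t ∧ cC n lam t ≤ aC n lam t ∧ cC n lam t ≤ bC n lam t)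
    (r : ℕ) (hr2 : 2 ≤ r) (hrs : r ≤ sC n lam)
    (hlen : 2 ≤ iC n lam r - iC n lam (r - 1))
    (hne' : (fun j => if j = iC n lam (r - 1) + 1 then n + 1 - j else lam j) ≠ lam)
    (hne'' : (fun j => if j = iC n lam r then n + 1 - j else lam j) ≠ lam) :
    IY n lam =
      - Cb (bC n lam (r - 1)) (cC n lam (r - 1)) *
          IY n (fun j => if j = iC n lam (r - 1) + 1 then n + 1 - j else lam j)
        - Cb (bC n lam r) (cC n lam r) *
          IY n (fun j => if j = iC n lam r then n + 1 - j else lam j) := by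
  have hr1 : 1 ≤ r := by omega
  have hmq := mem_cornerSet.1 (iC_mem_cornerSet hr1 hrs)
  have hmp := mem_cornerSet.1 (iC_mem_cornerSet (n := n) (lam := lam)
    (show 1 ≤ r - 1 by omega) (by omega))
  have hconst {j : ℕ} (h : iC n lam (r - 1) < j) (h' : j ≤ iC n lam r) :=
    lamE_eq_of_between hanti hr1 hrs h h'
  obtain ⟨hc0, hca, hcb⟩ := hcross r (Finset.mem_Icc.2 ⟨hr1, hrs⟩)
  obtain ⟨hc0', -, -⟩ := hcross (r - 1) (Finset.mem_Icc.2 ⟨by omega, by omega⟩)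
  have hlt1 := iC_lt_iC (n := n) (lam := lam) (show r - 1 - 1 < r - 1 by omega) (by omega)
  have hlt2 := iC_lt_iC (n := n) (lam := lam) (show r < r + 1 by omega) (by omega)
  have hinj : ∀ t ≤ sC n lam + 1, t ≠ r → iC n lam t ≠ iC n lam r := by
    intro t ht htr
    rcases lt_or_gt_of_ne htr with h | h
    · exact (iC_lt_iC h (by omega)).ne
    · exact (iC_lt_iC h ht).ne'
  have hgap : ∀ t ≤ sC n lam + 1, iC n lam t ≠ iC n lam (r - 1) + 1 := by
    intro t ht h
    rcases lt_trichotomy t r with h' | rfl | h'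
    · rcases (Nat.le_sub_one_of_lt h').eq_or_lt with rfl | h''
      · omega
      · have := iC_lt_iC (n := n) (lam := lam) h'' (by omega)
        omega
    · omega
    · have := iC_lt_iC (n := n) (lam := lam) h' ht
      omega
  have hp := hconst (show iC n lam (r - 1) < iC n lam (r - 1) + 1 by omega) (by omega)
  have hq1 := hconst (show iC n lam (r - 1) < iC n lam r - 1 by omega) (by omega)
  set mu' : ℕ → ℕ := fun j => if j = iC n lam (r - 1) + 1 then n + 1 - j else lam j with hmu'
  set mu'' : ℕ → ℕ := fun j => if j = iC n lam r then n + 1 - j else lam j with hmu''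
  have hE' : ∀ i, lamE n mu' i =
      if i = iC n lam (r - 1) + 1 then n + 1 - i else lamE n lam i := by
    intro i
    simp only [lamE, hmu']
    split_ifs <;> omega
  have hE'' : ∀ i, lamE n mu'' i = if i = iC n lam r then n + 1 - i else lamE n lam i := by
    intro i
    simp only [lamE, hmu'']
    split_ifs <;> omega
  have hLp : lamE n lam (iC n lam (r - 1) + 1) ≠ n + 1 - (iC n lam (r - 1) + 1) := by
    rintro h
    refine hne' (funext fun j => ?_)
    rw [lamE, if_pos (by omega)] at h
    simp only [hmu']
    split_ifs with hj
    · rw [hj, h]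
    · rfl
  have hLq : lamE n lam (iC n lam r) ≠ n + 1 - iC n lam r := by
    rintro h
    refine hne'' (funext fun j => ?_)
    rw [lamE, if_pos (by omega)] at h
    simp only [hmu'']
    split_ifs with hj
    · rw [hj, h]
    · rfl
  have hcpos : 1 ≤ cC n lam r := by unfold cC at *; omega
  have hclt : cC n lam r < aC n lam r := by unfold cC aC at *; omega
  have hset' : cornerSet n mu' = insert (iC n lam (r - 1) + 1) (cornerSet n lam) := by
    ext i
    rw [Finset.mem_insert, mem_cornerSet, mem_cornerSet, hE', hE']
    unfold cC aC bC at *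
    by_cases hi : i = iC n lam (r - 1) + 1
    · subst hi
      have := hconst (show iC n lam (r - 1) < iC n lam (r - 1) + 1 + 1 by omega) (by omega)
      simp
      omega
    · by_cases hi' : i = iC n lam (r - 1)
      · subst hi'
        simp
        omega
      · simp [hi, hi']
  have hset'' : cornerSet n mu'' = insert (iC n lam r - 1) (cornerSet n lam) := by
    ext i
    rw [Finset.mem_insert, mem_cornerSet, mem_cornerSet, hE'', hE'']
    unfold cC aC bC at *
    by_cases hi : i = iC n lam r
    · subst hi
      have hnext : lamE n lam (iC n lam r + 1) ≤ n - iC n lam r := by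
        by_cases hs : r = sC n lam
        · obtain ⟨t, ht1, hts, htn⟩ := exists_iC_eq (n := n) (lam := lam) (i := n)
            (mem_cornerSet.2 ⟨⟨hn, le_rfl⟩, by simpa [lamE] using hpos⟩)
          have : iC n lam r = n := by
            by_contra hne
            have := iC_lt_iC (n := n) (lam := lam) (t := t) (u := r)
              (lt_of_le_of_ne (hs ▸ hts) (by rintro rfl; exact hne htn)) (by omega)
            omega
          simp [lamE, this]
        · have := lamE_eq_of_between (r := r + 1) hanti (by omega) (by omega)
            (show iC n lam (r + 1 - 1) < iC n lam r + 1 by simp) hlt2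
          omega
      simp
      omega
    · by_cases hi' : i = iC n lam r - 1
      · subst hi'
        have : iC n lam r - 1 + 1 = iC n lam r := by omega
        rw [this]
        simp [hi]
        omega
      · have : i + 1 ≠ iC n lam r := by omega
        simp [hi, hi', this]
  have hI' := IY_insert hr2 hrs (Nat.lt_succ_self _) (by omega) hset' fun t ht _ => by
    rw [hE', if_neg (hgap t ht)]
  have hI'' := IY_insert hr2 hrs (by omega) (by omega) hset'' fun t ht htr => by
    rw [hE'', if_neg (hinj t ht htr)]
  have hx' : iC n lam (r - 1) < iC n lam (r - 1) + 1 := by omega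
  have hy' : iC n lam (r - 1) + 1 < iC n lam r := by omega
  have hx'' : iC n lam (r - 1) < iC n lam r - 1 := by omega
  have hy'' : iC n lam r - 1 < iC n lam r := by omega
  have hrr : r - 1 + 1 = r := by omega
  have e0' : iC n mu' (r - 1 - 1) = iC n lam (r - 1 - 1) :=
    iC_insert_of_lt hr1 hrs hx' hy' hset' (by omega)
  have e1' : iC n mu' (r - 1) = iC n lam (r - 1) :=
    iC_insert_of_lt hr1 hrs hx' hy' hset' (by omega)
  have e2' : iC n mu' r = iC n lam (r - 1) + 1 := iC_insert_self hr1 hrs hx' hy' hset'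
  have e3' : iC n mu' (r + 1) = iC n lam r := iC_insert_succ hr1 hrs hx' hy' hset' le_rfl
  have e4' : iC n mu' (r + 1 + 1) = iC n lam (r + 1) :=
    iC_insert_succ hr1 hrs hx' hy' hset' (by omega)
  have e0'' : iC n mu'' (r - 1 - 1) = iC n lam (r - 1 - 1) :=
    iC_insert_of_lt hr1 hrs hx'' hy'' hset'' (by omega)
  have e1'' : iC n mu'' (r - 1) = iC n lam (r - 1) :=
    iC_insert_of_lt hr1 hrs hx'' hy'' hset'' (by omega)
  have e2'' : iC n mu'' r = iC n lam r - 1 := iC_insert_self hr1 hrs hx'' hy'' hset''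
  have e3'' : iC n mu'' (r + 1) = iC n lam r := iC_insert_succ hr1 hrs hx'' hy'' hset'' le_rfl
  have e4'' : iC n mu'' (r + 1 + 1) = iC n lam (r + 1) :=
    iC_insert_succ hr1 hrs hx'' hy'' hset'' (by omega)
  have v1' : lamE n mu' (iC n lam (r - 1)) = lamE n lam (iC n lam (r - 1)) := by
    rw [hE', if_neg (by omega)]
  have v2' : lamE n mu' (iC n lam (r - 1) + 1) = n - iC n lam (r - 1) := by
    rw [hE', if_pos rfl]; omega
  have v3' : lamE n mu' (iC n lam r) = lamE n lam (iC n lam r) := by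
    rw [hE', if_neg (by omega)]
  have v4' : lamE n mu' (iC n lam (r + 1)) = lamE n lam (iC n lam (r + 1)) := by
    rw [hE', if_neg (by omega)]
  have v1'' : lamE n mu'' (iC n lam (r - 1)) = lamE n lam (iC n lam (r - 1)) := by
    rw [hE'', if_neg (by omega)]
  have v2'' : lamE n mu'' (iC n lam r - 1) = lamE n lam (iC n lam r) := by
    rw [hE'', if_neg (by omega), hq1]
  have v3'' : lamE n mu'' (iC n lam r) = n + 1 - iC n lam r := by
    rw [hE'', if_pos rfl]
  have v4'' : lamE n mu'' (iC n lam (r + 1)) = lamE n lam (iC n lam (r + 1)) := by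
    rw [hE'', if_neg (by omega)]
  have y1' : yC n mu' (r - 1) = Cb (aC n lam (r - 1)) (cC n lam (r - 1)) := by
    have hb : bC n mu' (r - 1) = cC n lam (r - 1) := by
      rw [bC, cC, hrr, e1', e2', v1', v2']; omega
    have hc : cC n mu' (r - 1) = cC n lam (r - 1) := by rw [cC, cC, e1', v1']
    have ha : aC n mu' (r - 1) = aC n lam (r - 1) := by rw [aC, aC, e0', e1']
    rw [yC, ha, hb, hc, Cb_self hc0', mul_one]
  have y2' : yC n mu' r = 1 := by
    have ha : aC n mu' r = 0 := by rw [aC, e1', e2']; omega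
    have hc : cC n mu' r = 0 := by rw [cC, e2', v2']; omega
    have hb : 0 ≤ bC n mu' r := by
      rw [bC, e2', e3', v2', v3']; unfold cC aC at *; omega
    rw [yC, ha, hc, Cb_self le_rfl, Cb_zero_right hb, mul_one]
  have y3' : yC n mu' (r + 1) =
      Cb (aC n lam r - 1) (cC n lam r) * Cb (bC n lam r) (cC n lam r) := by
    have ha : aC n mu' (r + 1) = aC n lam r - 1 := by
      rw [aC, aC, Nat.add_sub_cancel, e2', e3']; omega
    have hb : bC n mu' (r + 1) = bC n lam r := by rw [bC, bC, e3', e4', v3', v4']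
    have hc : cC n mu' (r + 1) = cC n lam r := by rw [cC, cC, e3', v3']
    rw [yC, ha, hb, hc]
  have y1'' : yC n mu'' (r - 1) = yC n lam (r - 1) := by
    simp only [yC, aC, bC, cC, hrr, e0'', e1'', e2'', v1'', v2'']
  have y2'' : yC n mu'' r = Cb (aC n lam r - 1) (cC n lam r - 1) := by
    have ha : aC n mu'' r = aC n lam r - 1 := by rw [aC, aC, e1'', e2'']; omega
    have hb : bC n mu'' r = cC n lam r - 1 := by
      rw [bC, cC, e2'', e3'', v2'', v3'']; omega
    have hc : cC n mu'' r = cC n lam r - 1 := by rw [cC, cC, e2'', v2'']; omega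
    rw [yC, ha, hb, hc, Cb_self (by omega), mul_one]
  have y3'' : yC n mu'' (r + 1) = 1 := by
    have ha : aC n mu'' (r + 1) = 0 := by
      rw [aC, Nat.add_sub_cancel, e2'', e3'']; omega
    have hc : cC n mu'' (r + 1) = 0 := by rw [cC, e3'', v3'']; omega
    have hb : 0 ≤ bC n mu'' (r + 1) := by
      rw [bC, e3'', e4'', v3'', v4'']; unfold cC bC at *; omega
    rw [yC, ha, hc, Cb_self le_rfl, Cb_zero_right hb, mul_one]
  rw [hI', hI'', y1', y2', y3', y1'', y2'', y3'', IY, prod_Icc_split _ hr2 hrs,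
    show yC n lam (r - 1) = Cb (aC n lam (r - 1)) (cC n lam (r - 1)) *
      Cb (bC n lam (r - 1)) (cC n lam (r - 1)) from rfl,
    show yC n lam r = Cb (aC n lam r) (cC n lam r) * Cb (bC n lam r) (cC n lam r) from rfl,
    Cb_pascal hcpos hclt]
  ring
end
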